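/- arXiv:2502.21064 — 2 statements merged into one kernel-verified Lean document; each statement's English description precedes it below -/
import Mathlib

section
/- Let A be an abelian category and U a d-rigid full additive subcategory. If the subcategory U^d(A) is closed under extensions in A, then Ext^j_{U^d(A)}(V,U) = 0 for all integers 0 < j < d and all U, V ∈ U, where Ext is computed via Yoneda extensions inside the exact category U^d(A). -/
open CategoryTheory CategoryTheory.Limits

universe v u

variable (A : Type u) [Category.{v} A] [Abelian A]

/-- An exact sequence `0 → Y → E_n → ⋯ → E_1 → X → 0` with `n` middle terms `E_n, …, E_1`,
encoded as an `ℕ`-indexed complex with `ob 0 ≅ X`, `ob (n+1) ≅ Y`, zero objects in degrees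
above `n+1`, exactness at every position `≥ 1` and an epimorphism at the bottom. -/
structure ExtSeq (n : ℕ) (X Y : A) where
  ob : ℕ → A
  d : ∀ i : ℕ, ob (i + 1) ⟶ ob i
  iso0 : ob 0 ≅ X
  isoTop : ob (n + 1) ≅ Y
  is_zero : ∀ i, n + 1 < i → IsZero (ob i)
  w : ∀ i, d (i + 1) ≫ d i = 0
  ex : ∀ i, (ShortComplex.mk (d (i + 1)) (d i) (w i)).Exact
  epi0 : Epi (d 0)

variable {A}

/-- A morphism of `n`-extensions inducing the identity on the two end terms. -/
structure ExtSeqHom {n : ℕ} {X Y : A} (s t : ExtSeq A n X Y) where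
  φ : ∀ i, s.ob i ⟶ t.ob i
  comm : ∀ i, s.d i ≫ φ i = φ (i + 1) ≫ t.d i
  φ0 : φ 0 = s.iso0.hom ≫ t.iso0.inv
  φTop : φ (n + 1) = s.isoTop.hom ≫ t.isoTop.inv

/-- Yoneda equivalence of `n`-fold extensions: the equivalence relation generated by the
existence of a morphism of extensions fixing the end terms. -/
def YonedaEquiv {n : ℕ} {X Y : A} : ExtSeq A n X Y → ExtSeq A n X Y → Prop :=
  Relation.EqvGen fun s t => Nonempty (ExtSeqHom s t)

variable (A) in
/-- `extVanish A n X Y` expresses the vanishing of the Yoneda Ext-group `Ext^n_A(X, Y)`: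
all `n`-fold extensions of `X` by `Y` are Yoneda equivalent. -/
def extVanish (n : ℕ) (X Y : A) : Prop :=
  ∀ s t : ExtSeq A n X Y, YonedaEquiv s t

variable (A) in
/-- `coresSet 𝒰 j` is the class `𝒰^j(A)` of objects `E` admitting an exact sequence
`0 → E → U^1 → ⋯ → U^j → 0` with all `U^i ∈ 𝒰`. -/
def coresSet (𝒰 : Set A) : ℕ → Set A
  | 0 => {E | IsZero E}
  | j + 1 => {E | ∃ (V : A) (f : E ⟶ V), V ∈ 𝒰 ∧ Mono f ∧ cokernel f ∈ coresSet 𝒰 j}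

variable (A) in
/-- `resSet 𝒰 j` is the class `𝒰_j(A)` of objects `E` admitting an exact sequence
`0 → U_j → ⋯ → U_1 → E → 0` with all `U_i ∈ 𝒰`. -/
def resSet (𝒰 : Set A) : ℕ → Set A
  | 0 => {E | IsZero E}
  | j + 1 => {E | ∃ (V : A) (f : V ⟶ E), V ∈ 𝒰 ∧ Epi f ∧ kernel f ∈ resSet 𝒰 j}

/-- The extension lies (admissibly) in the subcategory `𝒮`: all its terms and all the
images of its differentials (the splice objects) belong to `𝒮`. -/
def ExtSeq.allIn {n : ℕ} {X Y : A} (s : ExtSeq A n X Y) (𝒮 : Set A) : Prop :=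
  (∀ i, i ≤ n + 1 → s.ob i ∈ 𝒮) ∧ ∀ i, 1 ≤ i → i ≤ n → (image (s.d i) : A) ∈ 𝒮

/-- Yoneda equivalence computed inside the subcategory `𝒮`: the equivalence relation
generated by morphisms of extensions between extensions lying in `𝒮`. -/
def YonedaEquivIn (𝒮 : Set A) {n : ℕ} {X Y : A} :
    ExtSeq A n X Y → ExtSeq A n X Y → Prop :=
  Relation.EqvGen fun s t => s.allIn 𝒮 ∧ t.allIn 𝒮 ∧ Nonempty (ExtSeqHom s t)

variable (A) in
/-- `𝒰` is closed under `d`-extensions in `A`. -/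
def DExtClosed (𝒰 : Set A) (d : ℕ) : Prop :=
  ∀ (X Y : A), X ∈ 𝒰 → Y ∈ 𝒰 → ∀ s : ExtSeq A d X Y,
    ∃ t : ExtSeq A d X Y, (∀ i, 1 ≤ i → i ≤ d → t.ob i ∈ 𝒰) ∧ YonedaEquiv s t

universe w

section Eff
open HomologicalComplex DerivedCategory Abelian
variable {C : Type u} [Category.{v} C] [Abelian C]

lemma aux_epi {X : C} {K : CochainComplex C ℤ} {i : ℤ}
    (π : K ⟶ (CochainComplex.singleFunctor C i).obj X) [K.IsStrictlyLE i] [QuasiIsoAt π i] :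
    Epi (π.f i) := by
  have h0 : ∀ j, K.d i j = 0 := fun j => by
    by_cases h : i < j
    · exact (K.isZero_of_isStrictlyLE i j h).eq_of_tgt _ _
    · exact K.shape _ _ (by simp; omega)
  let e := K.iCyclesIso i (i + 1) (by simp) (h0 _)
  have he : IsIso (K.iCycles i) := e.isIso_hom
  let L : CochainComplex C ℤ := (single C (ComplexShape.up ℤ) i).obj X
  let π' : K ⟶ L := π
  have : QuasiIsoAt π' i := ‹QuasiIsoAt π i›
  have hL : IsIso (L.homologyπ i) := L.isIso_homologyπ (i-1) i (by simp) (by simp [L])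
  have hL2 : IsIso (L.iCycles i) := (L.iCyclesIso i (i + 1) (by simp) (by simp [L])).isIso_hom
  have h1 : K.homologyπ i ≫ homologyMap π' i = cyclesMap π' i ≫ L.homologyπ i := by simp
  have h3 : Epi (cyclesMap π' i ≫ L.homologyπ i) := by rw [← h1]; infer_instance
  have h4 : Epi (cyclesMap π' i) := (epi_comp_iff_of_isIso _ (L.homologyπ i)).1 h3
  have h2 : K.iCycles i ≫ π'.f i = cyclesMap π' i ≫ L.iCycles i := by simp
  have h5 : Epi (K.iCycles i ≫ π'.f i) := by rw [h2]; infer_instance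
  exact epi_of_epi (K.iCycles i) (π'.f i)

lemma aux_single {X : C} {K : CochainComplex C ℤ} {i : ℤ}
    (π : K ⟶ (single C (ComplexShape.up ℤ) i).obj X) (hπ : Epi (π.f i))
    (hd : ∀ k, (ComplexShape.up ℤ).Rel i k → 𝟙 (K.X i) ≫ K.d i k = 0) :
    Epi (π.f i ≫ (singleObjXSelf (ComplexShape.up ℤ) i X).hom) ∧
    (single C (ComplexShape.up ℤ) i).map (π.f i ≫ (singleObjXSelf (ComplexShape.up ℤ) i X).hom) =
      mkHomFromSingle (𝟙 (K.X i)) hd ≫ π := by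
  refine ⟨epi_comp _ _, ?_⟩
  apply HomologicalComplex.from_single_hom_ext
  rw [comp_f, mkHomFromSingle_f, single_map_f_self]
  simp

lemma aux_eff [HasDerivedCategory.{w} C] {X : C}
    {L : CochainComplex C ℤ} {i : ℤ}
    (φ : Q.obj ((CochainComplex.singleFunctor C i).obj X) ⟶ Q.obj L)
    (n : ℤ) (hn : n < i) [L.IsStrictlyLE n] :
    ∃ (P : C) (p : P ⟶ X), Epi p ∧ Q.map ((CochainComplex.singleFunctor C i).map p) ≫ φ = 0 := by
  obtain ⟨K, _, π, h, g, rfl⟩ := right_fac_of_isStrictlyLE φ i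
  have hπ : Epi (π.f i) := by
    rw [isIso_Q_map_iff_quasiIso] at h
    exact aux_epi π
  have hd : ∀ k, (ComplexShape.up ℤ).Rel i k → 𝟙 (K.X i) ≫ K.d i k = 0 := by
    rintro _ rfl
    apply (K.isZero_of_isStrictlyLE i (i + 1) (by simp)).eq_of_tgt
  let ι : (CochainComplex.singleFunctor C i).obj (K.X i) ⟶ K := mkHomFromSingle (𝟙 _) hd
  obtain ⟨hp, h1⟩ := aux_single π hπ hd
  let p : K.X i ⟶ X := π.f i ≫ (singleObjXSelf (ComplexShape.up ℤ) i X).hom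
  replace h1 : (CochainComplex.singleFunctor C i).map p = ι ≫ π := h1
  have h2 : ι ≫ g = 0 := by
    apply HomologicalComplex.from_single_hom_ext
    apply (L.isZero_of_isStrictlyLE n i hn).eq_of_tgt
  refine ⟨_, p, hp, ?_⟩
  rw [h1, Q.map_comp, Category.assoc, IsIso.hom_inv_id_assoc, ← Q.map_comp, h2, Q.map_zero]

lemma aux_eff_ext [HasExt.{w} C] {X Y : C} {n : ℕ} (e : Ext X Y (n + 1)) :
    ∃ (P : C) (p : P ⟶ X), Epi p ∧ (Ext.mk₀ p).comp e (zero_add _) = 0 := by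
  let := HasDerivedCategory.standard C
  let iso := ((singleFunctors C).shiftIso ((n + 1 : ℕ) : ℤ) (-((n + 1 : ℕ) : ℤ)) 0
    (by lia)).app Y
  let φ : (singleFunctor C 0).obj X ⟶ (singleFunctor C (-((n+1 : ℕ) : ℤ))).obj Y := e.hom ≫ iso.hom
  obtain ⟨P, p, hp, h⟩ := aux_eff
    (L := (CochainComplex.singleFunctor C (-((n + 1 : ℕ):ℤ))).obj Y) φ (-((n + 1 : ℕ):ℤ)) (by lia)
  refine ⟨P, p, hp, ?_⟩
  apply Ext.ext
  rw [← Ext.singleFunctor_map_comp_hom, Ext.zero_hom]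
  have h' : (singleFunctor C 0).map p ≫ e.hom ≫ iso.hom = 0 := h
  rw [← cancel_mono iso.hom, Category.assoc, h', zero_comp]
end Eff

section Seq
open Abelian

/-- A morphism of extensions over `α` and `β`. -/
structure SeqMor {n : ℕ} {X Y X' Y' : A} (s : ExtSeq A n X Y) (t : ExtSeq A n X' Y')
    (α : X ⟶ X') (β : Y ⟶ Y') where
  φ : ∀ i, s.ob i ⟶ t.ob i
  comm : ∀ i, s.d i ≫ φ i = φ (i + 1) ≫ t.d i
  φ0 : φ 0 ≫ t.iso0.hom = s.iso0.hom ≫ α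
  φTop : φ (n + 1) ≫ t.isoTop.hom = s.isoTop.hom ≫ β

def SeqMor.comp {n : ℕ} {X Y X' Y' X'' Y'' : A} {s : ExtSeq A n X Y} {t : ExtSeq A n X' Y'}
    {r : ExtSeq A n X'' Y''} {α : X ⟶ X'} {β : Y ⟶ Y'} {α' : X' ⟶ X''} {β' : Y' ⟶ Y''}
    (f : SeqMor s t α β) (g : SeqMor t r α' β') : SeqMor s r (α ≫ α') (β ≫ β') where
  φ i := f.φ i ≫ g.φ i
  comm i := by rw [← Category.assoc, f.comm, Category.assoc, g.comm, Category.assoc]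
  φ0 := by rw [Category.assoc, g.φ0, ← Category.assoc, f.φ0, Category.assoc]
  φTop := by rw [Category.assoc, g.φTop, ← Category.assoc, f.φTop, Category.assoc]

def SeqMor.toHom {n : ℕ} {X Y : A} {s t : ExtSeq A n X Y} {α : X ⟶ X} {β : Y ⟶ Y}
    (f : SeqMor s t α β) (hα : α = 𝟙 X) (hβ : β = 𝟙 Y) : ExtSeqHom s t where
  φ := f.φ
  comm := f.comm
  φ0 := by rw [← cancel_mono t.iso0.hom, f.φ0, hα]; simp
  φTop := by rw [← cancel_mono t.isoTop.hom, f.φTop, hβ]; simp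

def ExtSeqHom.toMor {n : ℕ} {X Y : A} {s t : ExtSeq A n X Y}
    (f : ExtSeqHom s t) : SeqMor s t (𝟙 X) (𝟙 Y) where
  φ := f.φ
  comm := f.comm
  φ0 := by rw [f.φ0]; simp
  φTop := by rw [f.φTop]; simp

def spOb (X E : A) (ob : ℕ → A) : ℕ → A
  | 0 => X
  | 1 => E
  | i + 2 => ob (i + 1)

def spD {X E : A} {ob : ℕ → A} (d : ∀ i, ob (i + 1) ⟶ ob i) (g : E ⟶ X) (f : ob 0 ⟶ E) :
    ∀ i, spOb X E ob (i + 1) ⟶ spOb X E ob i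
  | 0 => g
  | 1 => d 0 ≫ f
  | i + 2 => d (i + 1)

def seqSplice {n : ℕ} {Y : A} (S : ShortComplex A) (hS : S.ShortExact) (t : ExtSeq A n S.X₁ Y) :
    ExtSeq A (n + 1) S.X₃ Y where
  ob := spOb S.X₃ S.X₂ t.ob
  d := spD t.d S.g (t.iso0.hom ≫ S.f)
  iso0 := Iso.refl _
  isoTop := t.isoTop
  is_zero := by
    rintro (_ | _ | i) h
    · omega
    · omega
    · exact t.is_zero (i + 1) (by omega)
  w := by
    rintro (_ | _ | i)
    · have h : (t.d 0 ≫ t.iso0.hom ≫ S.f) ≫ S.g = 0 := by simp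
      exact h
    · have h : t.d 1 ≫ t.d 0 ≫ t.iso0.hom ≫ S.f = 0 := by
        rw [← Category.assoc, t.w, zero_comp]
      exact h
    · exact t.w (i + 1)
  ex := by
    rintro (_ | _ | i)
    · have := t.epi0
      let S' : ShortComplex A := ShortComplex.mk (t.d 0 ≫ t.iso0.hom ≫ S.f) S.g (by simp)
      let φ : S' ⟶ S := { τ₁ := t.d 0 ≫ t.iso0.hom, τ₂ := 𝟙 _, τ₃ := 𝟙 _ }
      have h1 : Epi φ.τ₁ := epi_comp _ _
      have h2 : IsIso φ.τ₂ := inferInstanceAs (IsIso (𝟙 _))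
      have h3 : Mono φ.τ₃ := inferInstanceAs (Mono (𝟙 _))
      exact (ShortComplex.exact_iff_of_epi_of_isIso_of_mono φ).2 hS.exact
    · have := hS.mono_f
      let S1 : ShortComplex A := ShortComplex.mk (t.d 1) (t.d 0) (t.w 0)
      let S' : ShortComplex A := ShortComplex.mk (t.d 1) (t.d 0 ≫ t.iso0.hom ≫ S.f) 
        (by rw [← Category.assoc, t.w, zero_comp])
      let φ : S1 ⟶ S' := { τ₁ := 𝟙 _, τ₂ := 𝟙 _, τ₃ := t.iso0.hom ≫ S.f }
      have h1 : Epi φ.τ₁ := inferInstanceAs (Epi (𝟙 _))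
      have h2 : IsIso φ.τ₂ := inferInstanceAs (IsIso (𝟙 _))
      have h3 : Mono φ.τ₃ := mono_comp _ _
      exact (ShortComplex.exact_iff_of_epi_of_isIso_of_mono φ).1 (t.ex 0)
    · exact t.ex (i + 1)
  epi0 := hS.epi_g

def tlOb (K : A) (ob : ℕ → A) : ℕ → A
  | 0 => K
  | i + 1 => ob (i + 2)

def tlD {K : A} {ob : ℕ → A} (d : ∀ i, ob (i + 1) ⟶ ob i) (k : ob 2 ⟶ K) :
    ∀ i, tlOb K ob (i + 1) ⟶ tlOb K ob i
  | 0 => k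
  | i + 1 => d (i + 2)

noncomputable def seqTail {n : ℕ} {X Y : A} (s : ExtSeq A (n + 1) X Y) :
    ExtSeq A n (kernel (s.d 0)) Y where
  ob := tlOb (kernel (s.d 0)) s.ob
  d := tlD s.d (kernel.lift _ (s.d 1) (s.w 0))
  iso0 := Iso.refl _
  isoTop := s.isoTop
  is_zero := by
    rintro (_ | i) h
    · omega
    · exact s.is_zero (i + 2) (by omega)
  w := by
    rintro (_ | i)
    · change s.d 2 ≫ kernel.lift _ (s.d 1) (s.w 0) = 0
      rw [← cancel_mono (kernel.ι _)]
      simp [s.w]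
    · exact s.w (i + 2)
  ex := by
    rintro (_ | i)
    · let S1 : ShortComplex A := ShortComplex.mk (s.d 2) (s.d 1) (s.w 1)
      let S' : ShortComplex A := ShortComplex.mk (s.d 2) (kernel.lift _ (s.d 1) (s.w 0)) 
        (by rw [← cancel_mono (kernel.ι _)]; simp [s.w])
      let φ : S' ⟶ S1 := { τ₁ := 𝟙 _, τ₂ := 𝟙 _, τ₃ := kernel.ι _ }
      have h1 : Epi φ.τ₁ := inferInstanceAs (Epi (𝟙 _))
      have h2 : IsIso φ.τ₂ := inferInstanceAs (IsIso (𝟙 _))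
      have h3 : Mono φ.τ₃ := inferInstanceAs (Mono (kernel.ι _))
      exact (ShortComplex.exact_iff_of_epi_of_isIso_of_mono φ).2 (s.ex 1)
    · exact s.ex (i + 2)
  epi0 := (s.ex 0).epi_kernelLift

noncomputable abbrev seqHead {n : ℕ} {X Y : A} (s : ExtSeq A n X Y) : ShortComplex A :=
  ShortComplex.mk (kernel.ι (s.d 0)) (s.d 0 ≫ s.iso0.hom) (by simp)

lemma seqHead_exact {n : ℕ} {X Y : A} (s : ExtSeq A n X Y) : (seqHead s).ShortExact := by
  have := s.epi0
  let S1 : ShortComplex A := ShortComplex.mk (kernel.ι (s.d 0)) (s.d 0) (by simp)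
  have h : S1.ShortExact := { exact := ShortComplex.exact_kernel _ }
  let e : S1 ≅ seqHead s := ShortComplex.isoMk (Iso.refl _) (Iso.refl _) s.iso0
    (by simp [S1, seqHead]) (by simp [S1, seqHead])
  exact ShortComplex.shortExact_of_iso e h

def spliceφ {X E X' E' : A} {ob ob' : ℕ → A} (φ : ∀ i, ob i ⟶ ob' i) (e : E ⟶ E') (x : X ⟶ X') :
    ∀ i, spOb X E ob i ⟶ spOb X' E' ob' i
  | 0 => x
  | 1 => e
  | i + 2 => φ (i + 1)

def spliceMor {n : ℕ} {Y Y' : A} {S S' : ShortComplex A} {hS : S.ShortExact} {hS' : S'.ShortExact}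
    {t : ExtSeq A n S.X₁ Y} {t' : ExtSeq A n S'.X₁ Y'} {β : Y ⟶ Y'} (f : S ⟶ S')
    (m : SeqMor t t' f.τ₁ β) : SeqMor (seqSplice S hS t) (seqSplice S' hS' t') f.τ₃ β where
  φ := spliceφ m.φ f.τ₂ f.τ₃
  comm := by
    rintro (_ | _ | i)
    · exact f.comm₂₃.symm
    · change (t.d 0 ≫ t.iso0.hom ≫ S.f) ≫ f.τ₂ = m.φ 1 ≫ t'.d 0 ≫ t'.iso0.hom ≫ S'.f
      rw [← reassoc_of% m.comm, reassoc_of% m.φ0, f.comm₁₂]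
      simp
    · exact m.comm (i + 1)
  φ0 := (Category.comp_id f.τ₃).trans (Category.id_comp f.τ₃).symm
  φTop := m.φTop

def toSpliceφ {X E : A} {ob : ℕ → A} (K : A) (x : ob 0 ⟶ X) (e : ob 1 ⟶ E) :
    ∀ i, ob i ⟶ spOb X E (tlOb K ob) i
  | 0 => x
  | 1 => e
  | i + 2 => 𝟙 (ob (i + 2))

def ofSpliceφ {X E : A} {ob : ℕ → A} (K : A) (x : X ⟶ ob 0) (e : E ⟶ ob 1) :
    ∀ i, spOb X E (tlOb K ob) i ⟶ ob i
  | 0 => x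
  | 1 => e
  | i + 2 => 𝟙 (ob (i + 2))

noncomputable def toSplice {n : ℕ} {X Y : A} (s : ExtSeq A (n + 1) X Y) :
    SeqMor s (seqSplice (seqHead s) (seqHead_exact s) (seqTail s)) (𝟙 X) (𝟙 Y) where
  φ := toSpliceφ (kernel (s.d 0)) s.iso0.hom (𝟙 _)
  comm := by
    rintro (_ | _ | i)
    · change s.d 0 ≫ s.iso0.hom = 𝟙 _ ≫ s.d 0 ≫ s.iso0.hom
      simp
    · change s.d 1 ≫ 𝟙 _ = 𝟙 _ ≫ kernel.lift _ (s.d 1) (s.w 0) ≫ 𝟙 _ ≫ kernel.ι _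
      simp
    · change s.d (i + 2) ≫ 𝟙 _ = 𝟙 _ ≫ s.d (i + 2)
      simp
  φ0 := by
    change s.iso0.hom ≫ 𝟙 _ = _
    rfl
  φTop := by
    change 𝟙 _ ≫ s.isoTop.hom = _
    simp

noncomputable def ofSplice {n : ℕ} {X Y : A} (s : ExtSeq A (n + 1) X Y) :
    SeqMor (seqSplice (seqHead s) (seqHead_exact s) (seqTail s)) s (𝟙 X) (𝟙 Y) where
  φ := ofSpliceφ (kernel (s.d 0)) s.iso0.inv (𝟙 _)
  comm := by
    rintro (_ | _ | i)
    · change (s.d 0 ≫ s.iso0.hom) ≫ s.iso0.inv = 𝟙 _ ≫ s.d 0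
      simp
    · change (kernel.lift _ (s.d 1) (s.w 0) ≫ 𝟙 _ ≫ kernel.ι _) ≫ 𝟙 _ = 𝟙 _ ≫ s.d 1
      simp
    · change s.d (i + 2) ≫ 𝟙 _ = 𝟙 _ ≫ s.d (i + 2)
      simp
  φ0 := by
    change s.iso0.inv ≫ s.iso0.hom = 𝟙 _ ≫ 𝟙 _
    simp
  φTop := by
    change 𝟙 _ ≫ s.isoTop.hom = s.isoTop.hom ≫ 𝟙 _
    simp

noncomputable def SeqMor.kerMap {n : ℕ} {X Y X' Y' : A} {s : ExtSeq A n X Y} {t : ExtSeq A n X' Y'}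
    {α : X ⟶ X'} {β : Y ⟶ Y'} (f : SeqMor s t α β) : kernel (s.d 0) ⟶ kernel (t.d 0) :=
  kernel.map _ _ (f.φ 1) (f.φ 0) (f.comm 0)

noncomputable def SeqMor.head {n : ℕ} {X Y X' Y' : A} {s : ExtSeq A n X Y} {t : ExtSeq A n X' Y'}
    {α : X ⟶ X'} {β : Y ⟶ Y'} (f : SeqMor s t α β) : seqHead s ⟶ seqHead t where
  τ₁ := kernel.map _ _ (f.φ 1) (f.φ 0) (f.comm 0)
  τ₂ := f.φ 1
  τ₃ := α
  comm₁₂ := by simp [seqHead]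
  comm₂₃ := by
    simp only [seqHead]
    rw [← reassoc_of% f.comm, f.φ0]
    simp

def tailφ {K K' : A} {ob ob' : ℕ → A} (φ : ∀ i, ob i ⟶ ob' i) (k : K ⟶ K') :
    ∀ i, tlOb K ob i ⟶ tlOb K' ob' i
  | 0 => k
  | i + 1 => φ (i + 2)

noncomputable def SeqMor.tail {n : ℕ} {X Y X' Y' : A} {s : ExtSeq A (n + 1) X Y}
    {t : ExtSeq A (n + 1) X' Y'}
    {α : X ⟶ X'} {β : Y ⟶ Y'} (f : SeqMor s t α β) :
    SeqMor (seqTail s) (seqTail t) f.head.τ₁ β where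
  φ := tailφ f.φ f.head.τ₁
  comm := by
    rintro (_ | i)
    · change kernel.lift _ (s.d 1) (s.w 0) ≫ kernel.map _ _ (f.φ 1) (f.φ 0) (f.comm 0) =
        f.φ 2 ≫ kernel.lift _ (t.d 1) (t.w 0)
      rw [← cancel_mono (kernel.ι _)]
      simp [f.comm]
    · exact f.comm (i + 2)
  φ0 := (Category.comp_id f.head.τ₁).trans (Category.id_comp f.head.τ₁).symm
  φTop := f.φTop

end Seq

section Cls
open Abelian ZeroObject

lemma isIso_d0 {X Y : A} (s : ExtSeq A 0 X Y) : IsIso (s.d 0) := by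
  have := s.epi0
  have h := s.ex 0
  have hz : s.d 1 = 0 := (s.is_zero 2 (by omega)).eq_of_src _ _
  have : Mono (s.d 0) := (h.mono_g_iff).2 hz
  exact isIso_of_mono_of_epi _

/-- The class of an extension in Mathlib's Ext group. -/
noncomputable def seqCls [HasExt.{w} A] {Y : A} : ∀ (n : ℕ) {X : A}, ExtSeq A n X Y → Ext.{w} X Y n
  | 0, _, s => Ext.mk₀ (s.iso0.inv ≫ @inv _ _ _ _ (s.d 0) (isIso_d0 s) ≫ s.isoTop.hom)
  | n + 1, _, s => ((seqHead_exact s).extClass).comp (seqCls n (seqTail s)) (add_comm 1 n)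

lemma ext_aux1 [HasExt.{w} A] {X X' K K' Y Y' : A} {n : ℕ} (e : Ext.{w} X K 1)
    (e' : Ext.{w} X' K' 1) (k : K ⟶ K') (α : X ⟶ X') (β : Y ⟶ Y') (c : Ext.{w} K Y n)
    (c' : Ext.{w} K' Y' n)
    (h1 : c.comp (Ext.mk₀ β) (add_zero n) = (Ext.mk₀ k).comp c' (zero_add n))
    (h2 : e.comp (Ext.mk₀ k) (add_zero 1) = (Ext.mk₀ α).comp e' (zero_add 1)) :
    (e.comp c (add_comm 1 n)).comp (Ext.mk₀ β) (add_zero (n + 1)) =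
      (Ext.mk₀ α).comp (e'.comp c' (add_comm 1 n)) (zero_add (n + 1)) := by
  rw [Ext.comp_assoc e c (Ext.mk₀ β) (add_comm 1 n) (add_zero n) (by omega), h1,
    ← Ext.comp_assoc e (Ext.mk₀ k) c' (add_zero 1) (zero_add n) (by omega), h2,
    Ext.comp_assoc (Ext.mk₀ α) e' c' (zero_add 1) (add_comm 1 n) (by omega)]

lemma seqCls_natural [HasExt.{w} A] {Y Y' : A} (β : Y ⟶ Y') (n : ℕ) :
    ∀ {X X' : A} {s : ExtSeq A n X Y} {t : ExtSeq A n X' Y'} {α : X ⟶ X'} (_ : SeqMor s t α β),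
    (seqCls n s).comp (Ext.mk₀ β) (add_zero n) = (Ext.mk₀ α).comp (seqCls n t) (zero_add n) := by
  induction n with
  | zero =>
    intro X X' s t α f
    have := isIso_d0 s
    have := isIso_d0 t
    simp only [seqCls, Ext.mk₀_comp_mk₀]
    congr 1
    rw [Category.assoc, Category.assoc, ← f.φTop, ← cancel_epi s.iso0.hom, ← cancel_epi (s.d 0)]
    rw [← reassoc_of% f.φ0, reassoc_of% f.comm]
    simp
  | succ n ih =>
    intro X X' s t α f
    exact ext_aux1 _ _ _ _ _ _ _ (ih f.tail) (ShortComplex.ShortExact.extClass_naturality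
      (seqHead_exact s) (seqHead_exact t) f.head)

def tailSpliceφ {X E : A} {ob : ℕ → A} {K : A} (k : ob 0 ⟶ K) :
    ∀ i, ob i ⟶ tlOb K (spOb X E ob) i
  | 0 => k
  | i + 1 => 𝟙 (ob (i + 1))

noncomputable def tailSplice {n : ℕ} {Y : A} (S : ShortComplex A) (hS : S.ShortExact)
    (t : ExtSeq A n S.X₁ Y) :
    SeqMor t (seqTail (seqSplice S hS t)) (kernel.lift S.g S.f S.zero) (𝟙 Y) where
  φ := tailSpliceφ (X := S.X₃) (E := S.X₂) (t.iso0.hom ≫ kernel.lift S.g S.f S.zero)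
  comm := by
    rintro (_ | i)
    · have h : t.d 0 ≫ t.iso0.hom ≫ kernel.lift S.g S.f S.zero =
          𝟙 _ ≫ kernel.lift S.g (t.d 0 ≫ t.iso0.hom ≫ S.f) (by simp) := by
        rw [← cancel_mono (kernel.ι _)]
        simp
      exact h
    · exact (Category.comp_id (t.d (i + 1))).trans (Category.id_comp (t.d (i + 1))).symm
  φ0 := Category.comp_id (t.iso0.hom ≫ kernel.lift S.g S.f S.zero)
  φTop := (Category.id_comp t.isoTop.hom).trans (Category.comp_id t.isoTop.hom).symm

noncomputable def headSplice {n : ℕ} {Y : A} (S : ShortComplex A) (hS : S.ShortExact)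
    (t : ExtSeq A n S.X₁ Y) : S ⟶ seqHead (seqSplice S hS t) where
  τ₁ := kernel.lift S.g S.f S.zero
  τ₂ := 𝟙 S.X₂
  τ₃ := 𝟙 S.X₃
  comm₁₂ := by
    have h : kernel.lift S.g S.f S.zero ≫ kernel.ι S.g = S.f ≫ 𝟙 _ := by simp
    exact h
  comm₂₃ := by
    have h : 𝟙 _ ≫ S.g ≫ 𝟙 _ = S.g ≫ 𝟙 _ := by simp
    exact h

lemma seqCls_splice [HasExt.{w} A] {n : ℕ} {Y : A} (S : ShortComplex A) (hS : S.ShortExact)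
    (t : ExtSeq A n S.X₁ Y) :
    seqCls (n + 1) (seqSplice S hS t) = hS.extClass.comp (seqCls n t) (add_comm 1 n) := by
  have h1 := seqCls_natural _ _ (tailSplice S hS t)
  have h2 := ShortComplex.ShortExact.extClass_naturality hS (seqHead_exact (seqSplice S hS t))
    (headSplice S hS t)
  have h3 := ext_aux1 _ _ _ _ _ _ _ h1 h2
  rw [Ext.comp_mk₀_id] at h3
  exact (h3.trans (Ext.mk₀_id_comp _)).symm

noncomputable def seqRefl (Y : A) : ExtSeq A 0 Y Y where
  ob := fun | 0 => Y | 1 => Y | _ + 2 => 0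
  d := fun | 0 => 𝟙 Y | _ + 1 => 0
  iso0 := Iso.refl _
  isoTop := Iso.refl _
  is_zero := by
    rintro (_ | _ | i) h
    · omega
    · omega
    · exact isZero_zero _
  w := by
    rintro (_ | i) <;> simp
  ex := by
    rintro (_ | i)
    · rw [ShortComplex.exact_iff_mono]
      · exact inferInstanceAs (Mono (𝟙 Y))
      · rfl
    · exact ShortComplex.exact_of_isZero_X₂ _ (isZero_zero _)
  epi0 := inferInstanceAs (Epi (𝟙 Y))

lemma seqCls_refl [HasExt.{w} A] (Y : A) : seqCls 0 (seqRefl Y) = Ext.mk₀ (𝟙 Y) := by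
  simp only [seqCls]
  congr 1
  have h : IsIso (𝟙 Y) := inferInstance
  have : 𝟙 Y ≫ inv (𝟙 Y) ≫ 𝟙 Y = 𝟙 Y := by simp
  exact this

/-- Pushout of a short exact sequence. -/
noncomputable abbrev poSeq (S : ShortComplex A) {K : A} (k : S.X₁ ⟶ K) : ShortComplex A :=
  ShortComplex.mk (pushout.inr S.f k)
    (pushout.desc S.g (0 : K ⟶ S.X₃) (by rw [S.zero, comp_zero])) (pushout.inr_desc _ _ _)

noncomputable def poMap (S : ShortComplex A) {K : A} (k : S.X₁ ⟶ K) : S ⟶ poSeq S k where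
  τ₁ := k
  τ₂ := pushout.inl S.f k
  τ₃ := 𝟙 S.X₃
  comm₁₂ := pushout.condition.symm
  comm₂₃ := (pushout.inl_desc _ _ _).trans (Category.comp_id _).symm

lemma poSeq_exact (S : ShortComplex A) (hS : S.ShortExact) {K : A} (k : S.X₁ ⟶ K) :
    (poSeq S k).ShortExact := by
  have := hS.mono_f
  have := hS.epi_g
  have h1 : Mono (poSeq S k).f := inferInstanceAs (Mono (pushout.inr S.f k))
  have h2 : Epi (poSeq S k).g := by
    have h3 : pushout.inl S.f k ≫ (poSeq S k).g = S.g := pushout.inl_desc _ _ _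
    have : Epi (pushout.inl S.f k ≫ (poSeq S k).g) := by
      rw [h3]; exact this
    exact epi_of_epi (pushout.inl S.f k) _
  refine { exact := ?_ }
  apply ShortComplex.exact_of_g_is_cokernel
  refine CokernelCofork.IsColimit.ofπ' _ _ (fun {T} (f : pushout S.f k ⟶ T) hf => ?_)
  have hf' : pushout.inr S.f k ≫ f = 0 := hf
  have h : S.f ≫ pushout.inl S.f k ≫ f = 0 := by
    rw [pushout.condition_assoc, hf', comp_zero]
  refine ⟨hS.exact.desc _ h, ?_⟩
  change pushout.desc S.g (0 : K ⟶ S.X₃) (by rw [S.zero, comp_zero]) ≫ hS.exact.desc _ h = f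
  apply pushout.hom_ext
  · rw [pushout.inl_desc_assoc, ShortComplex.Exact.g_desc]
  · rw [pushout.inr_desc_assoc, hf', zero_comp]

lemma seqCls_surj [HasExt.{w} A] {Y : A} (n : ℕ) : ∀ {X : A} (x : Ext.{w} X Y (n + 1)),
    ∃ s : ExtSeq A (n + 1) X Y, seqCls (n + 1) s = x := by
  induction n with
  | zero =>
    intro X x
    obtain ⟨P, p, hp, h⟩ := aux_eff_ext x
    let S : ShortComplex A := ShortComplex.mk (kernel.ι p) p (by simp)
    have hS : S.ShortExact := { exact := ShortComplex.exact_kernel _ }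
    obtain ⟨y, hy⟩ := Ext.contravariant_sequence_exact₃ hS Y x h (add_zero 1)
    obtain ⟨k, rfl⟩ := (Ext.mk₀_bijective _ _).2 y
    refine ⟨seqSplice (poSeq S k) (poSeq_exact S hS k) (seqRefl Y), ?_⟩
    rw [seqCls_splice]
    have := ShortComplex.ShortExact.extClass_naturality hS (poSeq_exact S hS k) (poMap S k)
    erw [seqCls_refl, Ext.comp_mk₀_id]
    rw [← hy]
    erw [this]
    exact (Ext.mk₀_id_comp _).symm
  | succ n ih =>
    intro X x
    obtain ⟨P, p, hp, h⟩ := aux_eff_ext x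
    let S : ShortComplex A := ShortComplex.mk (kernel.ι p) p (by simp)
    have hS : S.ShortExact := { exact := ShortComplex.exact_kernel _ }
    obtain ⟨y, hy⟩ := Ext.contravariant_sequence_exact₃ hS Y x h (add_comm 1 (n + 1))
    obtain ⟨s, hs⟩ := ih y
    refine ⟨seqSplice S hS s, ?_⟩
    rw [seqCls_splice, hs, hy]

lemma ext_zero_of_vanish [HasExt.{w} A] {X Y : A} (n : ℕ) (h0 : 0 < n) (h : extVanish A n X Y)
    (x : Ext.{w} X Y n) : x = 0 := by
  obtain ⟨n, rfl⟩ : ∃ m, n = m + 1 := ⟨n - 1, by omega⟩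
  have key : ∀ s t : ExtSeq A (n + 1) X Y, YonedaEquiv s t → (seqCls _ s : Ext.{w} X Y (n + 1)) = seqCls _ t := by
    intro s t hst
    induction hst with
    | rel s t hst =>
      obtain ⟨f⟩ := hst
      have := seqCls_natural (𝟙 Y) (n + 1) f.toMor
      rwa [Ext.comp_mk₀_id, Ext.mk₀_id_comp] at this
    | refl s => rfl
    | symm s t _ ih => exact ih.symm
    | trans s t r _ _ ih1 ih2 => exact ih1.trans ih2
  obtain ⟨s, hs⟩ := seqCls_surj n x
  obtain ⟨t, ht⟩ := seqCls_surj n (0 : Ext.{w} X Y (n + 1))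
  rw [← hs, ← ht]
  exact key s t (h s t)

end Cls

section Fin
open Abelian ZeroObject

lemma cores_zero (𝒰 : Set A) (hU0 : ∀ Z : A, IsZero Z → Z ∈ 𝒰) (k : ℕ) :
    ∀ Z : A, IsZero Z → Z ∈ coresSet A 𝒰 k := by
  induction k with
  | zero => exact fun Z hZ => hZ
  | succ k ih =>
    intro Z hZ
    exact ⟨Z, 𝟙 Z, hU0 Z hZ, inferInstance, ih _ (isZero_cokernel_of_epi (𝟙 Z))⟩

lemma cores_succ (𝒰 : Set A) (hU0 : ∀ Z : A, IsZero Z → Z ∈ 𝒰) (k : ℕ) :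
    ∀ Z : A, Z ∈ coresSet A 𝒰 k → Z ∈ coresSet A 𝒰 (k + 1) := by
  induction k with
  | zero => exact fun Z hZ => cores_zero 𝒰 hU0 1 Z hZ
  | succ k ih =>
    rintro Z ⟨V, f, hV, hf, hc⟩
    exact ⟨V, f, hV, hf, ih _ hc⟩

lemma cores_of_mem (𝒰 : Set A) (hU0 : ∀ Z : A, IsZero Z → Z ∈ 𝒰) (k : ℕ) (Z : A) (hZ : Z ∈ 𝒰) :
    Z ∈ coresSet A 𝒰 (k + 1) :=
  ⟨Z, 𝟙 Z, hZ, inferInstance, cores_zero 𝒰 hU0 k _ (isZero_cokernel_of_epi (𝟙 Z))⟩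

lemma splice_allIn {n : ℕ} {Y : A} (𝒮 : Set A)
    (hiso : ∀ X Y : A, (X ≅ Y) → X ∈ 𝒮 → Y ∈ 𝒮) (S : ShortComplex A) (hS : S.ShortExact)
    (t : ExtSeq A n S.X₁ Y) (ht : t.allIn 𝒮) (h2 : S.X₂ ∈ 𝒮) (h3 : S.X₃ ∈ 𝒮) :
    (seqSplice S hS t).allIn 𝒮 := by
  refine ⟨?_, ?_⟩
  · rintro (_ | _ | i) hi
    · exact h3
    · exact h2
    · exact ht.1 (i + 1) (by omega)
  · rintro (_ | _ | i) h1 hi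
    · omega
    · have := hS.mono_f
      have := t.epi0
      have h := hiso _ _ t.iso0 (ht.1 0 (by omega))
      have : Epi (t.d 0 ≫ t.iso0.hom) := epi_comp _ _
      have : StrongEpi (t.d 0 ≫ t.iso0.hom) := strongEpi_of_epi _
      exact hiso _ _ (image.isoStrongEpiMono (f := t.d 0 ≫ t.iso0.hom ≫ S.f)
        (t.d 0 ≫ t.iso0.hom) S.f (Category.assoc _ _ _)) h
    · exact ht.2 (i + 1) (by omega) (by omega)

lemma tail_allIn {n : ℕ} {X Y : A} (𝒮 : Set A)
    (hiso : ∀ X Y : A, (X ≅ Y) → X ∈ 𝒮 → Y ∈ 𝒮) 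
    (s : ExtSeq A (n + 1) X Y) (hs : s.allIn 𝒮) : (seqTail s).allIn 𝒮 := by
  refine ⟨?_, ?_⟩
  · rintro (_ | i) hi
    · have : Epi (kernel.lift _ (s.d 1) (s.w 0)) := (s.ex 0).epi_kernelLift
      have : StrongEpi (kernel.lift _ (s.d 1) (s.w 0)) := strongEpi_of_epi _
      exact hiso _ _ (image.isoStrongEpiMono (f := s.d 1)
        (kernel.lift _ (s.d 1) (s.w 0)) (kernel.ι _) (kernel.lift_ι _ _ _)).symm
        (hs.2 1 (by omega) (by omega))
    · exact hs.1 (i + 2) (by omega)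
  · rintro (_ | i) h1 hi
    · omega
    · exact hs.2 (i + 2) (by omega) (by omega)

lemma refl_allIn (Y : A) (𝒮 : Set A) (hY : Y ∈ 𝒮) : (seqRefl Y).allIn 𝒮 := by
  refine ⟨?_, ?_⟩
  · rintro (_ | _ | i) hi
    · exact hY
    · exact hY
    · omega
  · intro i h1 hi
    omega

noncomputable def fromReflφ {Y : A} (ob : ℕ → A) (a : Y ⟶ ob 0) (b : Y ⟶ ob 1) :
    ∀ i, (seqRefl Y).ob i ⟶ ob i
  | 0 => a
  | 1 => b
  | _ + 2 => 0

noncomputable def fromRefl {X Y : A} (t : ExtSeq A 0 X Y) :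
    SeqMor (seqRefl Y) t (t.isoTop.inv ≫ t.d 0 ≫ t.iso0.hom) (𝟙 Y) where
  φ := fromReflφ t.ob (t.isoTop.inv ≫ t.d 0) t.isoTop.inv
  comm := by
    rintro (_ | i)
    · exact Category.id_comp (t.isoTop.inv ≫ t.d 0)
    · exact (isZero_zero A).eq_of_src _ _
  φ0 := by
    have : (t.isoTop.inv ≫ t.d 0) ≫ t.iso0.hom =
      𝟙 Y ≫ (t.isoTop.inv ≫ t.d 0 ≫ t.iso0.hom) := by simp
    exact this
  φTop := by
    have : t.isoTop.inv ≫ t.isoTop.hom = 𝟙 Y ≫ 𝟙 Y := by simp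
    exact this

/-- The universal extension mapping to all others. -/
lemma exists_initial (𝒮 : Set A) (hiso : ∀ X Y : A, (X ≅ Y) → X ∈ 𝒮 → Y ∈ 𝒮)
    (hz : ∀ Z : A, IsZero Z → Z ∈ 𝒮) (U : A) (hU : U ∈ 𝒮) (n : ℕ) :
    ∃ (Z : A) (u : ExtSeq A n Z U), Z ∈ 𝒮 ∧ u.allIn 𝒮 ∧
      ∀ (X : A) (t : ExtSeq A n X U), ∃ z : Z ⟶ X, Nonempty (SeqMor u t z (𝟙 U)) := by
  induction n with
  | zero => exact ⟨U, seqRefl U, hU, refl_allIn U 𝒮 hU, fun X t => ⟨_, ⟨fromRefl t⟩⟩⟩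
  | succ n ih =>
    obtain ⟨Z, u, hZ, hu, H⟩ := ih
    let S : ShortComplex A := ShortComplex.mk (𝟙 Z) (0 : Z ⟶ 0) (by simp)
    have hg : Epi S.g := ⟨fun a b _ => (isZero_zero A).eq_of_src _ _⟩
    have hf : Mono S.f := inferInstanceAs (Mono (𝟙 Z))
    have hS : S.ShortExact := { exact := (S.exact_iff_epi rfl).2 (inferInstanceAs (Epi (𝟙 Z))) }
    refine ⟨0, seqSplice S hS u, hz _ (isZero_zero A),
      splice_allIn 𝒮 hiso S hS u hu hZ (hz _ (isZero_zero A)), ?_⟩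
    intro X t
    obtain ⟨z, ⟨m⟩⟩ := H _ (seqTail t)
    let f : S ⟶ seqHead t :=
      { τ₁ := z
        τ₂ := z ≫ kernel.ι (t.d 0)
        τ₃ := 0
        comm₁₂ := (Category.id_comp (z ≫ kernel.ι (t.d 0))).symm
        comm₂₃ := by simp }
    have m2 := (spliceMor (hS := hS) (hS' := seqHead_exact t) f m).comp (ofSplice t)
    rw [Category.comp_id (𝟙 U)] at m2
    exact ⟨_, ⟨m2⟩⟩

lemma embed_exact (S : ShortComplex A) (hS : S.ShortExact) {W : A} (f : S.X₂ ⟶ W) [Mono f] :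
    (ShortComplex.mk (S.f ≫ f) (pushout.inl f S.g) (by
      rw [Category.assoc, pushout.condition, S.zero_assoc, zero_comp])).ShortExact := by
  have := hS.mono_f
  have := hS.epi_g
  have h1 : Mono (S.f ≫ f) := mono_comp _ _
  have h2 : Epi (pushout.inl f S.g) := inferInstance
  refine { exact := ?_, mono_f := h1, epi_g := h2 }
  apply ShortComplex.exact_of_g_is_cokernel
  refine CokernelCofork.IsColimit.ofπ' _ _ (fun {T} (k : W ⟶ T) hk => ?_)
  have hk' : S.f ≫ f ≫ k = 0 := by
    have : (S.f ≫ f) ≫ k = 0 := hk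
    rwa [Category.assoc] at this
  refine ⟨pushout.desc k (hS.exact.desc _ hk') ?_, ?_⟩
  · rw [ShortComplex.Exact.g_desc]
  · exact pushout.inl_desc _ _ _

lemma push_lemma [HasExt.{w} A] (𝒰 𝒮 : Set A) (d : ℕ)
    (hUiso : ∀ X Y : A, (X ≅ Y) → X ∈ 𝒰 → Y ∈ 𝒰)
    (hiso : ∀ X Y : A, (X ≅ Y) → X ∈ 𝒮 → Y ∈ 𝒮)
    (hU𝒮 : ∀ X ∈ 𝒰, X ∈ 𝒮)
    (hext : ∀ S : ShortComplex A, S.ShortExact → S.X₁ ∈ 𝒮 → S.X₃ ∈ 𝒮 → S.X₂ ∈ 𝒮)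
    (hemb : ∀ E ∈ 𝒮, ∃ (W : A) (f : E ⟶ W), W ∈ 𝒰 ∧ Mono f ∧ cokernel f ∈ 𝒮)
    (hvan : ∀ V ∈ 𝒰, ∀ W ∈ 𝒰, ∀ i, 0 < i → i < d → ∀ x : Ext.{w} V W i, x = 0)
    (Y : A) (hY : Y ∈ 𝒰) (n : ℕ) :
    ∀ (X : A) (s : ExtSeq A n X Y), s.allIn 𝒮 →
      ∃ (X' : A) (α : X ⟶ X') (t : ExtSeq A n X' Y), t.allIn 𝒮 ∧ Nonempty (SeqMor s t α (𝟙 Y)) ∧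
        ∀ V ∈ 𝒰, ∀ i, 0 < i → i + n < d → ∀ x : Ext.{w} V X' i, x = 0 := by
  induction n with
  | zero =>
    intro X s hs
    have := isIso_d0 s
    refine ⟨X, 𝟙 X, s, hs, ⟨⟨fun i => 𝟙 _, by simp, by simp, by simp⟩⟩, ?_⟩
    intro V hV i h0 hi
    exact hvan V hV X (hUiso _ _ (s.isoTop.symm ≪≫ asIso (s.d 0) ≪≫ s.iso0) hY) i h0 (by omega)
  | succ n ih =>
    intro X s hs
    obtain ⟨K', a, t', ht', ⟨m⟩, hK⟩ := ih _ (seqTail s) (tail_allIn 𝒮 hiso s hs)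
    have hX : X ∈ 𝒮 := hiso _ _ s.iso0 (hs.1 0 (by omega))
    have hK' : K' ∈ 𝒮 := hiso _ _ t'.iso0 (ht'.1 0 (by omega))
    have hS1 := poSeq_exact (seqHead s) (seqHead_exact s) a
    have hE := hext _ hS1 hK' hX
    obtain ⟨W, f, hW, hf, hc⟩ := hemb _ hE
    have hS2 := embed_exact _ hS1 f
    have hc1 : (ShortComplex.mk f (cokernel.π f) (by simp)).ShortExact :=
      { exact := ShortComplex.exact_cokernel _ }
    have hX' : pushout f (poSeq (seqHead s) a).g ∈ 𝒮 :=
      hext _ (poSeq_exact _ hc1 (poSeq (seqHead s) a).g) hX hc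
    have h23 : ((poMap (seqHead s) a).τ₂ ≫ f) ≫ pushout.inl f (poSeq (seqHead s) a).g =
        (seqHead s).g ≫ pushout.inr f (poSeq (seqHead s) a).g := by
      have := (poMap (seqHead s) a).comm₂₃
      rw [Category.assoc, pushout.condition, ← Category.assoc, this]
      change ((seqHead s).g ≫ 𝟙 _) ≫ _ = _
      rw [Category.comp_id]
    let g : seqHead s ⟶ ShortComplex.mk ((poSeq (seqHead s) a).f ≫ f)
        (pushout.inl f (poSeq (seqHead s) a).g) (by
          rw [Category.assoc, pushout.condition, ShortComplex.zero_assoc, zero_comp]) :=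
      { τ₁ := a
        τ₂ := (poMap (seqHead s) a).τ₂ ≫ f
        τ₃ := pushout.inr f (poSeq (seqHead s) a).g
        comm₁₂ := by
          have := (poMap (seqHead s) a).comm₁₂
          change a ≫ (poSeq (seqHead s) a).f ≫ f = _
          rw [← Category.assoc, ← Category.assoc, ← this]
          rfl
        comm₂₃ := h23 }
    have m2 := (toSplice s).comp (spliceMor (hS := seqHead_exact s) (hS' := hS2) g m)
    rw [Category.comp_id (𝟙 Y)] at m2
    refine ⟨_, _, _, splice_allIn 𝒮 hiso _ hS2 t' ht' (hU𝒮 W hW) hX', ⟨m2⟩, ?_⟩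
    intro V hV i h0 hi x
    obtain ⟨x2, hx2⟩ := Ext.covariant_sequence_exact₃ V hS2 x rfl
      (hK V hV (i + 1) (by omega) (by omega) _)
    rw [← hx2, hvan V hV W hW i h0 (by omega) x2]
    exact Ext.zero_comp _ _ _ _ _

lemma exists_section [HasExt.{w} A] (S : ShortComplex A) (hS : S.ShortExact)
    (h : ∀ x : Ext.{w} S.X₃ S.X₁ 1, x = 0) : ∃ σ : S.X₃ ⟶ S.X₂, σ ≫ S.g = 𝟙 _ := by
  obtain ⟨x2, hx2⟩ := Ext.covariant_sequence_exact₃ S.X₃ hS (Ext.mk₀ (𝟙 S.X₃)) (zero_add 1) (h _)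
  obtain ⟨σ, rfl⟩ := (Ext.mk₀_bijective _ _).2 x2
  rw [Ext.mk₀_comp_mk₀] at hx2
  exact ⟨σ, (Ext.mk₀_bijective _ _).1 hx2⟩

lemma main_lemma [HasExt.{w} A] (𝒰 𝒮 : Set A) (d : ℕ)
    (hUiso : ∀ X Y : A, (X ≅ Y) → X ∈ 𝒰 → Y ∈ 𝒰)
    (hiso : ∀ X Y : A, (X ≅ Y) → X ∈ 𝒮 → Y ∈ 𝒮)
    (hz : ∀ Z : A, IsZero Z → Z ∈ 𝒮)
    (hU𝒮 : ∀ X ∈ 𝒰, X ∈ 𝒮)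
    (hext : ∀ S : ShortComplex A, S.ShortExact → S.X₁ ∈ 𝒮 → S.X₃ ∈ 𝒮 → S.X₂ ∈ 𝒮)
    (hemb : ∀ E ∈ 𝒮, ∃ (W : A) (f : E ⟶ W), W ∈ 𝒰 ∧ Mono f ∧ cokernel f ∈ 𝒮)
    (hvan : ∀ V ∈ 𝒰, ∀ W ∈ 𝒰, ∀ i, 0 < i → i < d → ∀ x : Ext.{w} V W i, x = 0)
    (n : ℕ) (hn : n + 1 < d) (U V : A) (hU : U ∈ 𝒰) (hV : V ∈ 𝒰) :
    ∃ T : ExtSeq A (n + 1) V U, ∀ s : ExtSeq A (n + 1) V U, s.allIn 𝒮 → YonedaEquivIn 𝒮 s T := by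
  obtain ⟨Z, u, hZ, hu, H⟩ := exists_initial 𝒮 hiso hz U (hU𝒮 U hU) n
  let S0 : ShortComplex A := ShortComplex.mk (biprod.inl : Z ⟶ Z ⊞ V) biprod.snd (by simp)
  have hS0 : S0.ShortExact := (ShortComplex.Splitting.ofHasBinaryBiproduct Z V).shortExact
  have hT : (seqSplice S0 hS0 u).allIn 𝒮 :=
    splice_allIn 𝒮 hiso S0 hS0 u hu (hext S0 hS0 hZ (hU𝒮 V hV)) (hU𝒮 V hV)
  refine ⟨seqSplice S0 hS0 u, fun s hs => ?_⟩
  obtain ⟨K', a, t', ht', ⟨m⟩, hK⟩ := push_lemma 𝒰 𝒮 d hUiso hiso hU𝒮 hext hemb hvan U hU n _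
    (seqTail s) (tail_allIn 𝒮 hiso s hs)
  have hK' : K' ∈ 𝒮 := hiso _ _ t'.iso0 (ht'.1 0 (by omega))
  have hS1 := poSeq_exact (seqHead s) (seqHead_exact s) a
  have hE := hext _ hS1 hK' (hU𝒮 V hV)
  obtain ⟨σ, hσ⟩ := exists_section _ hS1 (hK V hV 1 (by omega) (by omega))
  obtain ⟨z, ⟨mz⟩⟩ := H _ t'
  have hs' : (seqSplice (poSeq (seqHead s) a) hS1 t').allIn 𝒮 :=
    splice_allIn 𝒮 hiso _ hS1 t' ht' hE (hU𝒮 V hV)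
  have m1 := (toSplice s).comp (spliceMor (hS := seqHead_exact s) (hS' := hS1)
    (poMap (seqHead s) a) m)
  let g : S0 ⟶ poSeq (seqHead s) a :=
    { τ₁ := z
      τ₂ := biprod.desc (z ≫ (poSeq (seqHead s) a).f) σ
      τ₃ := 𝟙 V
      comm₁₂ := (biprod.inl_desc _ _).symm
      comm₂₃ := by
        change biprod.desc (z ≫ (poSeq (seqHead s) a).f) σ ≫ (poSeq (seqHead s) a).g =
          biprod.snd ≫ 𝟙 V
        apply biprod.hom_ext'
        · rw [biprod.inl_desc_assoc, Category.assoc, (poSeq (seqHead s) a).zero]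
          simp
        · rw [biprod.inr_desc_assoc, hσ]
          simp }
  have m2 := spliceMor (hS := hS0) (hS' := hS1) g mz
  have e1 : YonedaEquivIn 𝒮 s (seqSplice (poSeq (seqHead s) a) hS1 t') :=
    Relation.EqvGen.rel _ _ ⟨hs, hs', ⟨m1.toHom (Category.comp_id _) (Category.comp_id _)⟩⟩
  have e2 : YonedaEquivIn 𝒮 (seqSplice S0 hS0 u) (seqSplice (poSeq (seqHead s) a) hS1 t') :=
    Relation.EqvGen.rel _ _ ⟨hT, hs', ⟨m2.toHom rfl rfl⟩⟩
  exact Relation.EqvGen.trans _ _ _ e1 (Relation.EqvGen.symm _ _ e2)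

end Fin

/-- if `𝒰^d(A)` is closed under extensions, then the Yoneda Ext-groups
`Ext^j_{𝒰^d(A)}(V, U)` vanish for all `0 < j < d` and `U, V ∈ 𝒰`: any two admissible
`j`-fold extensions inside `𝒰^d(A)` are Yoneda equivalent in `𝒰^d(A)`. -/
theorem ext_vanish_in_coresSet
    (A : Type u) [Category.{v} A] [Abelian A] (d : ℕ) (hd : 1 ≤ d)
    (𝒰 : Set A)
    (hU0 : ∀ Z : A, IsZero Z → Z ∈ 𝒰)
    (hUadd : ∀ X Y : A, X ∈ 𝒰 → Y ∈ 𝒰 → (X ⊞ Y) ∈ 𝒰)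
    (hUiso : ∀ X Y : A, (X ≅ Y) → X ∈ 𝒰 → Y ∈ 𝒰)
    (hrigid : ∀ i, 0 < i → i < d → ∀ U ∈ 𝒰, ∀ U' ∈ 𝒰, extVanish A i U U')
    (hext : ∀ S : ShortComplex A, S.ShortExact → S.X₁ ∈ coresSet A 𝒰 d →
      S.X₃ ∈ coresSet A 𝒰 d → S.X₂ ∈ coresSet A 𝒰 d) :
    ∀ j, 0 < j → j < d → ∀ U ∈ 𝒰, ∀ V ∈ 𝒰, ∀ s t : ExtSeq A j V U,
      s.allIn (coresSet A 𝒰 d) → t.allIn (coresSet A 𝒰 d) →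
        YonedaEquivIn (coresSet A 𝒰 d) s t := by
  have hE := HasExt.standard A
  obtain ⟨k, rfl⟩ : ∃ k, d = k + 1 := ⟨d - 1, by omega⟩
  have hz := cores_zero 𝒰 hU0 (k + 1)
  have hiso : ∀ X Y : A, (X ≅ Y) → X ∈ coresSet A 𝒰 (k + 1) → Y ∈ coresSet A 𝒰 (k + 1) := by
    intro X Y e hX
    have hc := isZero_cokernel_of_epi e.hom
    have hS : (ShortComplex.mk e.hom (cokernel.π e.hom) (by simp)).ShortExact :=
      { exact := ShortComplex.exact_cokernel _ }
    exact hext _ hS hX (hz _ hc)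
  intro j h0 hj U hU V hV s t hs ht
  obtain ⟨n, rfl⟩ : ∃ n, j = n + 1 := ⟨j - 1, by omega⟩
  obtain ⟨T, hT⟩ := main_lemma 𝒰 (coresSet A 𝒰 (k + 1)) (k + 1) hUiso hiso hz
    (cores_of_mem 𝒰 hU0 k) hext
    (fun E ⟨W, f, hW, hf, hc⟩ => ⟨W, f, hW, hf, cores_succ 𝒰 hU0 k _ hc⟩)
    (fun V hV W hW i h0 hi => ext_zero_of_vanish i h0 (hrigid i h0 hi V hV W hW))
    n hj U V hU hV
  exact Relation.EqvGen.trans _ _ _ (hT s hs) (Relation.EqvGen.symm _ _ (hT t ht))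
end

section
/- Let A be an abelian category and U a d-rigid full additive subcategory which is d-extension closed in A. Then the canonical map Ext^d_{U^d(A)}(U,V) → Ext^d_A(U,V) induced by the inclusion of the extension-closed subcategory U^d(A) into A is a bijection for all U, V ∈ U. -/
open CategoryTheory CategoryTheory.Limits

universe v u

variable (A : Type u) [Category.{v} A] [Abelian A]

variable {A}

universe w

section efface
open HomologicalComplex DerivedCategory Abelian Category

variable {C : Type u} [Category.{v} C] [Abelian C]

lemma exists_epi_to_single
    {P : C} {K : CochainComplex C ℤ} {i : ℤ}
    (π : K ⟶ (HomologicalComplex.single C (ComplexShape.up ℤ) i).obj P) [K.IsStrictlyLE i] [QuasiIsoAt π i] :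
    ∃ (E : C) (p : E ⟶ P) (σ : (HomologicalComplex.single C (ComplexShape.up ℤ) i).obj E ⟶ K), Epi p ∧
      σ ≫ π = (HomologicalComplex.single C (ComplexShape.up ℤ) i).map p := by
  let e := K.iCyclesIso i (i + 1) (by simp)
    ((K.isZero_of_isStrictlyLE i (i + 1) (by simp)).eq_of_tgt _ _)
  let α := e.inv ≫ K.homologyπ i ≫ homologyMap π i ≫ (singleObjHomologySelfIso _ _ _).hom
  have hπ : π.f i = α ≫ (singleObjXSelf (ComplexShape.up ℤ) i P).inv := by
    rw [← cancel_epi e.hom]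
    dsimp only [α, e]
    rw [assoc, assoc, assoc, Iso.hom_inv_id_assoc, iCyclesIso_hom,
      homologyπ_naturality_assoc]
    rw [homologyπ_singleObjHomologySelfIso_hom_assoc,
      ← singleObjCyclesSelfIso_inv_iCycles, Iso.hom_inv_id_assoc, ← cyclesMap_i]
  refine ⟨K.X i, α, mkHomFromSingle (𝟙 _) (by
      rintro _ rfl
      apply (K.isZero_of_isStrictlyLE i (i + 1) (by simp)).eq_of_tgt), ?_, ?_⟩
  · dsimp only [α]
    infer_instance
  · apply HomologicalComplex.from_single_hom_ext
    rw [comp_f, mkHomFromSingle_f, hπ, single_map_f_self]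
    simp

lemma exists_epi_to_single'
    {P : C} {K : CochainComplex C ℤ} {i : ℤ}
    (π : K ⟶ (CochainComplex.singleFunctor C i).obj P) [K.IsStrictlyLE i] [hq : QuasiIsoAt π i] :
    ∃ (E : C) (p : E ⟶ P) (σ : (CochainComplex.singleFunctor C i).obj E ⟶ K), Epi p ∧
      σ ≫ π = (CochainComplex.singleFunctor C i).map p ∧
      ∀ (L : CochainComplex C ℤ) (g : K ⟶ L), IsZero (L.X i) → σ ≫ g = 0 := by
  obtain ⟨E, p, σ, hp, hσ⟩ := @exists_epi_to_single _ _ _ _ _ i π _ hq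
  refine ⟨E, p, σ, hp, hσ, fun L g hL => ?_⟩
  apply HomologicalComplex.from_single_hom_ext
  apply hL.eq_of_tgt

lemma efface_Q [HasDerivedCategory.{w} C] {P : C}
    {L : CochainComplex C ℤ} {i : ℤ}
    (φ : Q.obj ((CochainComplex.singleFunctor C i).obj P) ⟶ Q.obj L)
    (n : ℤ) (hn : n < i) [L.IsStrictlyLE n] :
    ∃ (E : C) (p : E ⟶ P), Epi p ∧ Q.map ((CochainComplex.singleFunctor C i).map p) ≫ φ = 0 := by
  obtain ⟨K, _, π, h, g, rfl⟩ := right_fac_of_isStrictlyLE φ i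
  have h' := h
  rw [isIso_Q_map_iff_quasiIso] at h'
  obtain ⟨E, p, σ, hp, hσ, h₂⟩ := exists_epi_to_single' (i := i) π
  have h₁ : Q.map ((CochainComplex.singleFunctor C i).map p) ≫ inv (Q.map π) = Q.map σ := by
    rw [IsIso.comp_inv_eq, ← Q.map_comp]
    exact congrArg _ hσ.symm
  refine ⟨E, p, hp, ?_⟩
  rw [reassoc_of% h₁, ← Q.map_comp, h₂ L g (L.isZero_of_isStrictlyLE n i hn), Q.map_zero]

lemma efface_ext [HasExt.{w} C] {P Y : C} {n : ℕ}
    (x : Ext P Y (n + 1)) : ∃ (E : C) (p : E ⟶ P), Epi p ∧ (Ext.mk₀ p).comp x (zero_add _) = 0 := by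
  let := HasDerivedCategory.standard C
  let I := ((singleFunctors C).shiftIso (n + 1) (-(n + 1)) 0 (by lia)).hom.app Y
  obtain ⟨E, p, hp, h⟩ := efface_Q (P := P) 
    (L := (CochainComplex.singleFunctor C (-(n + 1))).obj Y) (n := -(n + 1)) (i := 0)
    (x.hom ≫ I) (by lia)
  refine ⟨E, p, hp, ?_⟩
  apply Ext.homEquiv.injective
  change ((Ext.mk₀ p).comp x (zero_add _)).hom = (0 : Ext _ _ _).hom
  rw [Ext.comp_hom, Ext.mk₀_hom, ShiftedHom.mk₀_comp, Ext.zero_hom]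
  rw [← cancel_mono I, Limits.zero_comp, assoc]
  exact h
end efface

section chains

open ZeroObject

/-- An infinite chain of short exact sequences `0 → B (i+1) → E i → B i → 0`. -/
structure Ch (A : Type u) [Category.{v} A] [Abelian A] where
  B : ℕ → A
  E : ℕ → A
  ι : ∀ i, B (i + 1) ⟶ E i
  π : ∀ i, E i ⟶ B i
  w : ∀ i, ι i ≫ π i = 0
  se : ∀ i, (ShortComplex.mk (ι i) (π i) (w i)).ShortExact

lemma Ch.w_assoc (C : Ch A) (i : ℕ) {Z : A} (h : C.B i ⟶ Z) :
    C.ι i ≫ C.π i ≫ h = 0 ≫ h := by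
  rw [← Category.assoc, C.w]

namespace Ch

instance (C : Ch A) (i : ℕ) : Mono (C.ι i) := (C.se i).mono_f

instance (C : Ch A) (i : ℕ) : Epi (C.π i) := (C.se i).epi_g

/-- Morphisms of chains. -/
structure Hom (C D : Ch A) where
  β : ∀ i, C.B i ⟶ D.B i
  ε : ∀ i, C.E i ⟶ D.E i
  hι : ∀ i, C.ι i ≫ ε i = β (i + 1) ≫ D.ι i
  hπ : ∀ i, C.π i ≫ β i = ε i ≫ D.π i

lemma Hom.hι_assoc {C D : Ch A} (F : Hom C D) (i : ℕ) {Z : A} (h : D.E i ⟶ Z) :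
    C.ι i ≫ F.ε i ≫ h = F.β (i + 1) ≫ D.ι i ≫ h := by
  rw [← Category.assoc, F.hι, Category.assoc]

lemma Hom.hπ_assoc {C D : Ch A} (F : Hom C D) (i : ℕ) {Z : A} (h : D.B i ⟶ Z) :
    C.π i ≫ F.β i ≫ h = F.ε i ≫ D.π i ≫ h := by
  rw [← Category.assoc, F.hπ, Category.assoc]

/-- Dropping the bottom short exact sequence. -/
abbrev tail (C : Ch A) : Ch A where
  B i := C.B (i + 1)
  E i := C.E (i + 1)
  ι i := C.ι (i + 1)
  π i := C.π (i + 1)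
  w i := C.w (i + 1)
  se i := C.se (i + 1)

/-- Adding a short exact sequence at the bottom. -/
def cons (C : Ch A) {E X : A} (f : C.B 0 ⟶ E) (g : E ⟶ X) (w : f ≫ g = 0)
    (h : (ShortComplex.mk f g w).ShortExact) : Ch A where
  B | 0 => X
    | i + 1 => C.B i
  E | 0 => E
    | i + 1 => C.E i
  ι | 0 => f
    | i + 1 => C.ι i
  π | 0 => g
    | i + 1 => C.π i
  w | 0 => w
    | i + 1 => C.w i
  se | 0 => h
     | i + 1 => C.se i

/-- Extending a morphism by one step at the bottom. -/
def Hom.cons {C D : Ch A} {E X : A} {f : D.B 0 ⟶ E} {g : E ⟶ X} {w : f ≫ g = 0}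
    {h : (ShortComplex.mk f g w).ShortExact} (F : Hom C.tail D)
    (e : C.E 0 ⟶ E) (b : C.B 0 ⟶ X) (h1 : C.ι 0 ≫ e = F.β 0 ≫ f) (h2 : C.π 0 ≫ b = e ≫ g) :
    Hom C (D.cons f g w h) where
  β | 0 => b
    | i + 1 => F.β i
  ε | 0 => e
    | i + 1 => F.ε i
  hι | 0 => h1
     | i + 1 => F.hι i
  hπ | 0 => h2
     | i + 1 => F.hπ i

/-- `C` is zero above `n`. -/
def Bdd (C : Ch A) (n : ℕ) : Prop := ∀ i, n < i → IsZero (C.B i)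

lemma Bdd.tail {C : Ch A} {n : ℕ} (h : C.Bdd (n + 1)) : C.tail.Bdd n :=
  fun i hi => h (i + 1) (by lia)

lemma Bdd.cons {C : Ch A} {n : ℕ} (hC : C.Bdd n) {E X : A} (f : C.B 0 ⟶ E) (g : E ⟶ X)
    (w : f ≫ g = 0) (h : (ShortComplex.mk f g w).ShortExact) : (C.cons f g w h).Bdd (n + 1) := by
  intro i hi
  obtain _ | i := i
  · lia
  · exact hC i (by lia)

lemma isZero_mid {S : ShortComplex A} (h : S.Exact) (h1 : IsZero S.X₁) (h3 : IsZero S.X₃) :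
    IsZero S.X₂ := h.isZero_of_both_zeros (h1.eq_of_src _ _) (h3.eq_of_tgt _ _)

lemma Bdd.isZeroE {C : Ch A} {n : ℕ} (hC : C.Bdd n) (i : ℕ) (hi : n < i) : IsZero (C.E i) :=
  isZero_mid (C.se i).exact (hC _ (by simp; lia)) (hC _ hi)

lemma Bdd.isIso_π {C : Ch A} {n : ℕ} (hC : C.Bdd n) : IsIso (C.π n) := by
  have : Mono (C.π n) := (C.se n).exact.mono_g ((hC _ (by lia)).eq_of_src _ _)
  exact isIso_of_mono_of_epi _

/-- The trivial chain. -/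
noncomputable def triv (Y : A) : Ch A where
  B | 0 => Y
    | _ + 1 => 0
  E | 0 => Y
    | _ + 1 => 0
  ι | 0 => (0 : (0 : A) ⟶ Y)
    | _ + 1 => (0 : (0 : A) ⟶ 0)
  π | 0 => 𝟙 Y
    | _ + 1 => (0 : (0 : A) ⟶ 0)
  w | 0 => by simp
    | _ + 1 => by simp
  se | 0 => by
        have : Mono (0 : (0 : A) ⟶ Y) := (isZero_zero A).mono _
        exact { exact := by rw [ShortComplex.exact_iff_mono _ rfl]; dsimp; infer_instance }
     | _ + 1 => by
        have h1 : Mono (0 : (0 : A) ⟶ 0) := (isZero_zero A).mono _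
        have h2 : Epi (0 : (0 : A) ⟶ 0) := (isZero_zero A).epi _
        exact { exact := ShortComplex.exact_of_isZero_X₂ _ (isZero_zero A) }

lemma triv_bdd (Y : A) : (triv Y).Bdd 0 := by
  intro i hi
  obtain _ | i := i
  · lia
  · exact isZero_zero A

/-- Build a morphism of chains from its components on the middle terms. -/
noncomputable def Hom.ofE {C D : Ch A} (ε : ∀ i, C.E i ⟶ D.E i) (b : C.B 0 ⟶ D.B 0)
    (h0 : C.π 0 ≫ b = ε 0 ≫ D.π 0)
    (h : ∀ i, (C.π (i + 1) ≫ C.ι i) ≫ ε i = ε (i + 1) ≫ D.π (i + 1) ≫ D.ι i) : Hom C D :=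
  have key : ∀ i, (C.ι i ≫ ε i) ≫ D.π i = 0 := fun i => by
    rw [← cancel_epi (C.π (i + 1))]
    have := h i =≫ D.π i
    simp only [Category.assoc, D.w, comp_zero] at this ⊢
    exact this
  { β := fun i => match i with
      | 0 => b
      | i + 1 => (D.se i).exact.lift (C.ι i ≫ ε i) (key i)
    ε := ε
    hι := fun i => ((D.se i).exact.lift_f (C.ι i ≫ ε i) (key i)).symm
    hπ := fun i => match i with
      | 0 => h0
      | i + 1 => by
        rw [← cancel_mono (D.ι i)]
        have := (D.se i).exact.lift_f (C.ι i ≫ ε i) (key i)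
        dsimp only at this ⊢
        rw [Category.assoc, Category.assoc, this, ← h i, Category.assoc] }

open Abelian

variable [HasExt.{w} A]

/-- The class of a chain. -/
noncomputable def cl (C : Ch A) : ∀ n, Ext.{w} (C.B 0) (C.B n) n
  | 0 => Ext.mk₀ (𝟙 _)
  | n + 1 => (cl C n).comp (C.se n).extClass rfl

lemma Hom.nat {C D : Ch A} (F : Hom C D) (i : ℕ) :
    (C.se i).extClass.comp (Ext.mk₀ (F.β (i + 1))) (add_zero 1) =
      (Ext.mk₀ (F.β i)).comp (D.se i).extClass (zero_add 1) :=
  (C.se i).extClass_naturality (D.se i)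
    { τ₁ := F.β (i + 1), τ₂ := F.ε i, τ₃ := F.β i, comm₁₂ := (F.hι i).symm, comm₂₃ := (F.hπ i).symm }

lemma Hom.cl_nat {C D : Ch A} (F : Hom C D) (n : ℕ) :
    (C.cl n).comp (Ext.mk₀ (F.β n)) (add_zero n) =
      (Ext.mk₀ (F.β 0)).comp (D.cl n) (zero_add n) := by
  induction n with
  | zero => simp [cl]
  | succ n ih =>
    rw [cl, cl, Ext.comp_assoc_of_third_deg_zero, F.nat, ← Ext.comp_assoc_of_second_deg_zero, ih,
      Ext.comp_assoc (a₂₃ := n + 1)]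
    lia

lemma cl_tail (C : Ch A) (n : ℕ) :
    C.cl (n + 1) = (C.se 0).extClass.comp (C.tail.cl n) (Nat.add_comm 1 n) := by
  induction n with
  | zero =>
    simp only [cl]
    rw [Ext.mk₀_id_comp]
    exact (Ext.comp_mk₀_id _).symm
  | succ n ih =>
    rw [cl, ih]
    exact Ext.comp_assoc (C.se 0).extClass (C.tail.cl n) (C.se (n + 1)).extClass _ rfl (by lia)

end Ch

end chains

section decompositions

open Abelian

variable {n : ℕ} {X Y : A}

/-- A decomposition of an `n`-extension into short exact sequences. -/
structure Dec (s : ExtSeq A n X Y) (C : Ch A) where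
  e0 : s.ob 0 ≅ C.B 0
  e : ∀ i, s.ob (i + 1) ≅ C.E i
  comm0 : s.d 0 ≫ e0.hom = (e 0).hom ≫ C.π 0
  comm : ∀ i, s.d (i + 1) ≫ (e i).hom = (e (i + 1)).hom ≫ C.π (i + 1) ≫ C.ι i

namespace Dec

variable {s t : ExtSeq A n X Y} {C D : Ch A}

lemma bdd (c : Dec s C) : C.Bdd n := by
  intro i hi
  obtain ⟨i, rfl⟩ : ∃ k, i = k + 1 := ⟨i - 1, by lia⟩
  exact IsZero.of_epi (C.π (i + 1)) ((s.is_zero (i + 2) (by lia)).of_iso (c.e (i + 1)).symm)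

/-- The identification of the bottom term. -/
def bot (c : Dec s C) : C.B 0 ≅ X := c.e0.symm ≪≫ s.iso0

/-- The identification of the top term. -/
noncomputable def top (c : Dec s C) : C.B n ≅ Y :=
  haveI := c.bdd.isIso_π
  (asIso (C.π n)).symm ≪≫ (c.e n).symm ≪≫ s.isoTop

lemma π_top (c : Dec s C) : C.π n ≫ c.top.hom = (c.e n).inv ≫ s.isoTop.hom := by
  simp [top]

/-- The morphism of chains induced by a morphism of extensions. -/
noncomputable def homOf (c : Dec s C) (d : Dec t D) (φ : ExtSeqHom s t) : Ch.Hom C D :=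
  Ch.Hom.ofE (fun i => (c.e i).inv ≫ φ.φ (i + 1) ≫ (d.e i).hom)
    (c.e0.inv ≫ φ.φ 0 ≫ d.e0.hom)
    (by
      rw [← cancel_epi (c.e 0).hom, ← reassoc_of% c.comm0]
      simp [reassoc_of% (φ.comm 0), d.comm0])
    (fun i => by
      rw [← cancel_epi (c.e (i + 1)).hom]
      have h1 := c.comm i =≫ ((c.e i).inv ≫ φ.φ (i + 1) ≫ (d.e i).hom)
      simp only [Category.assoc, Iso.hom_inv_id_assoc] at h1 ⊢
      rw [← h1, reassoc_of% (φ.comm (i + 1)), d.comm])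

lemma homOf_bot (c : Dec s C) (d : Dec t D) (φ : ExtSeqHom s t) :
    (c.homOf d φ).β 0 ≫ d.bot.hom = c.bot.hom := by
  simp [homOf, Ch.Hom.ofE, bot, φ.φ0]

lemma homOf_top (c : Dec s C) (d : Dec t D) (φ : ExtSeqHom s t) :
    (c.homOf d φ).β n ≫ d.top.hom = c.top.hom := by
  rw [← cancel_epi (C.π n), (c.homOf d φ).hπ_assoc, π_top, π_top]
  simp [homOf, Ch.Hom.ofE, φ.φTop]

/-- The morphism of extensions induced by a morphism of chains. -/
def toExtSeqHom (c : Dec s C) (d : Dec t D) (F : Ch.Hom C D)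
    (h0 : F.β 0 ≫ d.bot.hom = c.bot.hom) (hn : F.β n ≫ d.top.hom = c.top.hom) :
    ExtSeqHom s t where
  φ | 0 => s.iso0.hom ≫ t.iso0.inv
    | i + 1 => (c.e i).hom ≫ F.ε i ≫ (d.e i).inv
  comm | 0 => by
          have h : s.iso0.hom ≫ t.iso0.inv = c.e0.hom ≫ F.β 0 ≫ d.e0.inv := by
            rw [Iso.comp_inv_eq]
            simpa [bot, Iso.inv_comp_eq] using h0.symm
          dsimp only
          rw [h, reassoc_of% c.comm0, F.hπ_assoc]
          simp only [Category.assoc]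
          congr 2
          rw [Iso.comp_inv_eq, Category.assoc, d.comm0, Iso.inv_hom_id_assoc]
       | i + 1 => by
          rw [reassoc_of% c.comm i, F.hι_assoc, F.hπ_assoc]
          simp only [Category.assoc]
          congr 2
          rw [Iso.eq_inv_comp]
          simp only [← Category.assoc]
          rw [Iso.comp_inv_eq]
          simp only [Category.assoc]
          rw [d.comm]
  φ0 := rfl
  φTop := by
    dsimp only
    rw [← cancel_mono t.isoTop.hom]
    simp only [Category.assoc, Iso.inv_hom_id, Category.comp_id]
    rw [← d.π_top, ← F.hπ_assoc, hn, c.π_top, Iso.hom_inv_id_assoc]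

variable [HasExt.{w} A]

/-- The class of an extension, computed with a decomposition. -/
noncomputable def cls (c : Dec s C) : Ext.{w} X Y n :=
  (Ext.mk₀ c.bot.inv).comp ((C.cl n).comp (Ext.mk₀ c.top.hom) (add_zero n)) (zero_add n)

lemma cls_eq_of_hom (c : Dec s C) (d : Dec t D) (φ : ExtSeqHom s t) : c.cls = d.cls := by
  unfold cls
  have h := (c.homOf d φ).cl_nat n
  rw [← c.homOf_top d φ, ← Ext.mk₀_comp_mk₀, ← Ext.comp_assoc_of_second_deg_zero, h,
    Ext.comp_assoc_of_third_deg_zero, Ext.mk₀_comp_mk₀_assoc]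
  congr 2
  rw [Iso.inv_comp_eq, ← c.homOf_bot d φ, Category.assoc, Iso.hom_inv_id, Category.comp_id]

end Dec

/-- The identity morphism. -/
def ExtSeqHom.id (s : ExtSeq A n X Y) : ExtSeqHom s s where
  φ i := 𝟙 _
  comm := by simp
  φ0 := by simp
  φTop := by simp

lemma exact_image {P Q R : A} (f : P ⟶ Q) (g : Q ⟶ R) (w : f ≫ g = 0)
    (h : (ShortComplex.mk f g w).Exact) :
    ∃ w', (ShortComplex.mk (Limits.image.ι f) (factorThruImage g) w').ShortExact := by
  have w1 : f ≫ factorThruImage g = 0 := by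
    rw [← cancel_mono (Limits.image.ι g)]; simp [w]
  have w' : Limits.image.ι f ≫ factorThruImage g = 0 := by
    rw [← cancel_epi (factorThruImage f)]; simp [w1]
  refine ⟨w', ?_⟩
  let T := ShortComplex.mk f g w
  let T1 := ShortComplex.mk f (factorThruImage g) w1
  let T2 := ShortComplex.mk (Limits.image.ι f) (factorThruImage g) w'
  let φ : T1 ⟶ T := { τ₁ := 𝟙 _, τ₂ := 𝟙 _, τ₃ := Limits.image.ι g }
  let ψ : T1 ⟶ T2 := { τ₁ := factorThruImage f, τ₂ := 𝟙 _, τ₃ := 𝟙 _ }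
  have h1 : Epi φ.τ₁ := by dsimp [φ]; infer_instance
  have h2 : IsIso φ.τ₂ := by dsimp [φ]; infer_instance
  have h3 : Mono φ.τ₃ := by dsimp [φ]; infer_instance
  have h4 : Epi ψ.τ₁ := by dsimp [ψ]; infer_instance
  have h5 : IsIso ψ.τ₂ := by dsimp [ψ]; infer_instance
  have h6 : Mono ψ.τ₃ := by dsimp [ψ]; infer_instance
  have hT : T.Exact := h
  rw [← ShortComplex.exact_iff_of_epi_of_isIso_of_mono φ,
    ShortComplex.exact_iff_of_epi_of_isIso_of_mono ψ] at hT
  exact { exact := hT }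

/-- The canonical chain of an extension. -/
noncomputable def ExtSeq.ch (s : ExtSeq A n X Y) : Ch A where
  B i := image (s.d i)
  E i := s.ob (i + 1)
  ι i := Limits.image.ι (s.d (i + 1))
  π i := factorThruImage (s.d i)
  w i := (exact_image _ _ _ (s.ex i)).choose
  se i := (exact_image _ _ _ (s.ex i)).choose_spec

/-- The canonical decomposition of an extension. -/
noncomputable def ExtSeq.dec (s : ExtSeq A n X Y) : Dec s s.ch where
  e0 :=
    haveI := s.epi0
    haveI : Epi (Limits.image.ι (s.d 0)) := epi_of_epi_fac (Limits.image.fac (s.d 0))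
    haveI : IsIso (Limits.image.ι (s.d 0)) := isIso_of_mono_of_epi _
    (asIso (Limits.image.ι (s.d 0))).symm
  e i := Iso.refl _
  comm0 := by
    simp [ExtSeq.ch]
  comm i := by simp [ExtSeq.ch]

/-- The extension associated with a bounded chain. -/
noncomputable def Ch.toExtSeq (C : Ch A) (hC : C.Bdd n) (i : C.B 0 ≅ X) (j : C.B n ≅ Y) :
    ExtSeq A n X Y where
  ob | 0 => C.B 0
     | i + 1 => C.E i
  d | 0 => C.π 0
    | i + 1 => C.π (i + 1) ≫ C.ι i
  iso0 := i
  isoTop :=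
    haveI := hC.isIso_π
    asIso (C.π n) ≪≫ j
  is_zero i hi := by
    obtain _ | i := i
    · lia
    · exact hC.isZeroE i (by lia)
  w | 0 => by simp [C.w]
    | i + 1 => by simp [C.w_assoc]
  ex | 0 => by
        let S := ShortComplex.mk (C.π 1 ≫ C.ι 0) (C.π 0) (by simp [C.w])
        let T := ShortComplex.mk (C.ι 0) (C.π 0) (C.w 0)
        let φ : S ⟶ T := { τ₁ := C.π 1, τ₂ := 𝟙 _, τ₃ := 𝟙 _ }
        have h1 : Epi φ.τ₁ := by dsimp [φ]; infer_instance
        have h2 : IsIso φ.τ₂ := by dsimp [φ]; infer_instance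
        have h3 : Mono φ.τ₃ := by dsimp [φ]; infer_instance
        exact (ShortComplex.exact_iff_of_epi_of_isIso_of_mono φ).2 (C.se 0).exact
     | i + 1 => by
        let S := ShortComplex.mk (C.π (i + 2) ≫ C.ι (i + 1)) (C.π (i + 1)) (by simp [C.w])
        let T := ShortComplex.mk (C.ι (i + 1)) (C.π (i + 1)) (C.w (i + 1))
        let R := ShortComplex.mk (C.π (i + 2) ≫ C.ι (i + 1)) (C.π (i + 1) ≫ C.ι i)
          (by simp [C.w_assoc])
        let φ : S ⟶ T := { τ₁ := C.π (i + 2), τ₂ := 𝟙 _, τ₃ := 𝟙 _ }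
        have h1 : Epi φ.τ₁ := by dsimp [φ]; infer_instance
        have h2 : IsIso φ.τ₂ := by dsimp [φ]; infer_instance
        have h3 : Mono φ.τ₃ := by dsimp [φ]; infer_instance
        let ψ : S ⟶ R := { τ₁ := 𝟙 _, τ₂ := 𝟙 _, τ₃ := C.ι i }
        have h4 : Epi ψ.τ₁ := by dsimp [ψ]; infer_instance
        have h5 : IsIso ψ.τ₂ := by dsimp [ψ]; infer_instance
        have h6 : Mono ψ.τ₃ := by dsimp [ψ]; infer_instance
        exact (ShortComplex.exact_iff_of_epi_of_isIso_of_mono ψ).1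
          ((ShortComplex.exact_iff_of_epi_of_isIso_of_mono φ).2 (C.se (i + 1)).exact)
  epi0 := by dsimp only; infer_instance

/-- The tautological decomposition. -/
noncomputable def Ch.dec (C : Ch A) (hC : C.Bdd n) (i : C.B 0 ≅ X) (j : C.B n ≅ Y) :
    Dec (C.toExtSeq hC i j) C where
  e0 := Iso.refl _
  e i := Iso.refl _
  comm0 := by simp [Ch.toExtSeq]
  comm i := by simp [Ch.toExtSeq]

lemma Ch.dec_bot (C : Ch A) (hC : C.Bdd n) (i : C.B 0 ≅ X) (j : C.B n ≅ Y) :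
    (C.dec hC i j).bot.hom = i.hom := by
  simp [Ch.dec, Dec.bot, Ch.toExtSeq]

lemma Ch.dec_top (C : Ch A) (hC : C.Bdd n) (i : C.B 0 ≅ X) (j : C.B n ≅ Y) :
    (C.dec hC i j).top.hom = j.hom := by
  rw [← cancel_epi (C.π n), Dec.π_top]
  simp [Ch.dec, Ch.toExtSeq]

variable [HasExt.{w} A]

/-- The class of an extension. -/
noncomputable def ExtSeq.cls (s : ExtSeq A n X Y) : Ext.{w} X Y n := s.dec.cls

lemma Dec.cls_eq {s : ExtSeq A n X Y} {C : Ch A} (c : Dec s C) : c.cls = s.cls :=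
  c.cls_eq_of_hom s.dec (ExtSeqHom.id s)

lemma YonedaEquiv.cls_eq {s t : ExtSeq A n X Y} (h : YonedaEquiv s t) : s.cls = t.cls := by
  induction h with
  | rel s t h => exact s.dec.cls_eq_of_hom t.dec h.some
  | refl s => rfl
  | symm s t _ h => exact h.symm
  | trans s t r _ _ h1 h2 => exact h1.trans h2

lemma Ch.cls_toExtSeq (C : Ch A) (hC : C.Bdd n) (i : C.B 0 ≅ X) (j : C.B n ≅ Y) :
    (C.toExtSeq hC i j).cls =
      (Ext.mk₀ i.inv).comp ((C.cl n).comp (Ext.mk₀ j.hom) (add_zero n)) (zero_add n) := by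
  have h : (C.dec hC i j).bot = i := by
    ext1; exact C.dec_bot hC i j
  rw [← (C.dec hC i j).cls_eq, Dec.cls, C.dec_top, h]

end decompositions

section representation

open Abelian

lemma ses_of_isPushout {S : ShortComplex A} (hS : S.ShortExact) {Y P : A} {f : S.X₁ ⟶ Y}
    {q : S.X₂ ⟶ P} {i : Y ⟶ P} (sq : IsPushout S.f f q i) :
    ∃ p : P ⟶ S.X₃, q ≫ p = S.g ∧ ∃ w : i ≫ p = 0, (ShortComplex.mk i p w).ShortExact := by
  have := hS.mono_f
  have := hS.epi_g
  let p : P ⟶ S.X₃ := sq.desc S.g 0 (by simp)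
  have hp : q ≫ p = S.g := sq.inl_desc _ _ _
  have w : i ≫ p = 0 := sq.inr_desc _ _ _
  refine ⟨p, hp, w, ?_⟩
  have hi : Mono i := by
    have : Mono (pushout.inr S.f f) := inferInstance
    rw [← sq.inr_isoPushout_inv] 
    exact mono_comp _ _
  have he : Epi p := epi_of_epi_fac hp
  refine { exact := ?_ }
  apply ShortComplex.exact_of_g_is_cokernel
  refine CokernelCofork.IsColimit.ofπ _ _
    (fun k hk => hS.exact.desc (q ≫ k) (by rw [← Category.assoc, sq.w, Category.assoc, hk, comp_zero]))
    (fun k hk => ?_) (fun k hk m hm => ?_)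
  · apply sq.hom_ext
    · rw [← Category.assoc, hp, hS.exact.g_desc]
    · rw [← Category.assoc, w, zero_comp]; exact hk.symm
  · rw [← cancel_epi p, hm]
    symm
    apply sq.hom_ext
    · rw [← Category.assoc, hp, hS.exact.g_desc]
    · rw [← Category.assoc, w, zero_comp]; exact hk.symm

variable [HasExt.{w} A]

lemma exists_ch (n : ℕ) : ∀ (X Y : A) (x : Ext.{w} X Y (n + 1)),
    ∃ (C : Ch A) (_ : C.Bdd (n + 1)) (i : C.B 0 ≅ X) (j : C.B (n + 1) ≅ Y),
      (Ext.mk₀ i.inv).comp ((C.cl (n + 1)).comp (Ext.mk₀ j.hom) (add_zero _)) (zero_add _) = x := by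
  induction n with
  | zero =>
    intro X Y x
    obtain ⟨E, p, hp, h⟩ := efface_ext x
    let S := ShortComplex.mk (kernel.ι p) p (kernel.condition p)
    have hS : S.ShortExact := { exact := ShortComplex.exact_kernel p }
    obtain ⟨y, hy⟩ := Ext.contravariant_sequence_exact₃ hS Y x h (n₀ := 0) rfl
    obtain ⟨f, rfl⟩ := (Ext.mk₀_bijective _ _).2 y
    obtain ⟨g, hg, w, hT⟩ := ses_of_isPushout hS (IsPushout.of_hasPushout S.f f)
    refine ⟨(Ch.triv Y).cons _ g w hT, (Ch.triv_bdd Y).cons _ _ _ _, Iso.refl _, Iso.refl _, ?_⟩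
    have nat := hS.extClass_naturality hT
      { τ₁ := f, τ₂ := pushout.inl S.f f, τ₃ := 𝟙 _, comm₁₂ := (pushout.condition).symm,
        comm₂₃ := by simpa using hg }
    dsimp only at nat
    rw [hy, Ext.mk₀_id_comp] at nat
    rw [nat]
    refine (Ext.mk₀_id_comp _).trans ((Ext.comp_mk₀_id _).trans ?_)
    exact Ext.mk₀_id_comp _
  | succ n ih =>
    intro X Y x
    obtain ⟨E, p, hp, h⟩ := efface_ext x
    let S := ShortComplex.mk (kernel.ι p) p (kernel.condition p)
    have hS : S.ShortExact := { exact := ShortComplex.exact_kernel p }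
    obtain ⟨y, hy⟩ := Ext.contravariant_sequence_exact₃ hS Y x h (n₀ := n + 1) (by lia)
    obtain ⟨C, hC, i, j, hc⟩ := ih (kernel p) Y y
    have w : (i.hom ≫ kernel.ι p) ≫ p = 0 := by simp
    have hT : (ShortComplex.mk _ _ w).ShortExact := by
      refine ShortComplex.shortExact_of_iso (S₁ := S) (ShortComplex.isoMk i.symm (Iso.refl _) (Iso.refl _) ?_ ?_) hS
      · simp [S]
      · simp [S]
    refine ⟨C.cons _ _ w hT, hC.cons _ _ _ _, Iso.refl _, j, ?_⟩
    have nat := hT.extClass_naturality hS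
      { τ₁ := i.hom, τ₂ := 𝟙 _, τ₃ := 𝟙 _, comm₁₂ := by simp [S], comm₂₃ := by simp [S] }
    dsimp only at nat
    refine (Ext.mk₀_id_comp _).trans ?_
    rw [Ch.cl_tail]
    rw [Ext.mk₀_id_comp] at nat
    rw [← hy, ← nat, ← hc, Ext.comp_assoc_of_second_deg_zero]
    simp only [Ext.mk₀_comp_mk₀_assoc, Iso.hom_inv_id, Ext.mk₀_id_comp]
    exact Ext.comp_assoc_of_third_deg_zero _ _ _ _

lemma ext_eq_zero_of_extVanish {n : ℕ} (hn : 0 < n) {X Y : A} (h : extVanish A n X Y)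
    (x : Ext.{w} X Y n) : x = 0 := by
  obtain ⟨n, rfl⟩ : ∃ k, n = k + 1 := ⟨n - 1, by lia⟩
  obtain ⟨C, hC, i, j, hc⟩ := exists_ch n X Y x
  obtain ⟨D, hD, i', j', hd⟩ := exists_ch n X Y (0 : Ext.{w} X Y (n + 1))
  rw [← hc, ← hd, ← C.cls_toExtSeq hC, ← D.cls_toExtSeq hD]
  exact (h _ _).cls_eq

end representation

section coresolutions

open Abelian

lemma coresSet_iso (𝒰 : Set A) (hUiso : ∀ X Y : A, (X ≅ Y) → X ∈ 𝒰 → Y ∈ 𝒰) (j : ℕ) :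
    ∀ {X Y : A}, (X ≅ Y) → X ∈ coresSet A 𝒰 j → Y ∈ coresSet A 𝒰 j := by
  induction j with
  | zero => exact fun e hX => IsZero.of_iso hX e.symm
  | succ j ih =>
    rintro X Y e ⟨V, f, hV, hf, hc⟩
    exact ⟨V, e.inv ≫ f, hV, mono_comp _ _, ih (cokernelEpiComp e.inv f).symm hc⟩

lemma coresSet_of_ses (𝒰 : Set A) (hUiso : ∀ X Y : A, (X ≅ Y) → X ∈ 𝒰 → Y ∈ 𝒰) {j : ℕ}
    {S : ShortComplex A} (hS : S.ShortExact) (h2 : S.X₂ ∈ 𝒰) (h3 : S.X₃ ∈ coresSet A 𝒰 j) :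
    S.X₁ ∈ coresSet A 𝒰 (j + 1) := by
  refine ⟨S.X₂, S.f, h2, hS.mono_f, coresSet_iso 𝒰 hUiso j ?_ h3⟩
  exact (hS.gIsCokernel.coconePointUniqueUpToIso (colimit.isColimit (parallelPair S.f 0)))

lemma coresSet_ses (𝒰 : Set A) {j : ℕ} {X : A} (hX : X ∈ coresSet A 𝒰 (j + 1)) :
    ∃ (V K : A) (f : X ⟶ V) (g : V ⟶ K) (w : f ≫ g = 0),
      (ShortComplex.mk f g w).ShortExact ∧ V ∈ 𝒰 ∧ K ∈ coresSet A 𝒰 j := by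
  obtain ⟨V, f, hV, hf, hc⟩ := hX
  exact ⟨V, _, f, cokernel.π f, cokernel.condition f,
    { exact := ShortComplex.exact_cokernel f }, hV, hc⟩

lemma coresSet_mono (𝒰 : Set A) (hU0 : ∀ Z : A, IsZero Z → Z ∈ 𝒰) (j : ℕ) :
    coresSet A 𝒰 j ⊆ coresSet A 𝒰 (j + 1) := by
  induction j with
  | zero =>
    intro X hX
    have hX : IsZero X := hX
    exact ⟨X, 𝟙 X, hU0 X hX, inferInstance, IsZero.of_epi (cokernel.π (𝟙 X)) hX⟩
  | succ j ih =>
    rintro X ⟨V, f, hV, hf, hc⟩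
    exact ⟨V, f, hV, hf, ih hc⟩

lemma coresSet_le (𝒰 : Set A) (hU0 : ∀ Z : A, IsZero Z → Z ∈ 𝒰) {i j : ℕ} (h : i ≤ j) :
    coresSet A 𝒰 i ⊆ coresSet A 𝒰 j :=
  monotone_nat_of_le_succ (f := coresSet A 𝒰) (coresSet_mono 𝒰 hU0) h

lemma mem_coresSet_one (𝒰 : Set A) {X : A} (hX : X ∈ 𝒰) : X ∈ coresSet A 𝒰 1 :=
  ⟨X, 𝟙 X, hX, inferInstance, by
    change IsZero _
    rw [IsZero.iff_id_eq_zero, ← cancel_epi (cokernel.π (𝟙 X))]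
    have := cokernel.condition (𝟙 X)
    rw [Category.id_comp] at this
    simp [this]⟩

/-- Third isomorphism theorem. -/
lemma third_iso {X P K W C : A} {a : X ⟶ P} {b : P ⟶ K} {w1 : a ≫ b = 0}
    (h1 : (ShortComplex.mk a b w1).ShortExact) {c : P ⟶ W} {e : W ⟶ C} {w2 : c ≫ e = 0}
    (h2 : (ShortComplex.mk c e w2).ShortExact) :
    ∃ (Q : A) (q : W ⟶ Q) (u : K ⟶ Q) (v : Q ⟶ C), b ≫ u = c ≫ q ∧ q ≫ v = e ∧
      (∃ w, (ShortComplex.mk (a ≫ c) q w).ShortExact) ∧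
      (∃ w, (ShortComplex.mk u v w).ShortExact) := by
  have : Epi b := h1.epi_g
  have : Mono a := h1.mono_f
  have : Mono c := h2.mono_f
  have sq : IsPushout c b (pushout.inl c b) (pushout.inr c b) := IsPushout.of_hasPushout c b
  obtain ⟨v, hv, w, hse⟩ := ses_of_isPushout h2 (f := b) sq
  refine ⟨pushout c b, pushout.inl c b, pushout.inr c b, v, sq.w.symm, hv, ?_, w, hse⟩
  have w3 : (a ≫ c) ≫ pushout.inl c b = 0 := by
    rw [Category.assoc, sq.w, reassoc_of% w1, zero_comp]
  refine ⟨w3, ?_⟩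
  have hm : Mono (a ≫ c) := mono_comp _ _
  have he : Epi (pushout.inl c b) := inferInstance
  refine { exact := ?_ }
  apply ShortComplex.exact_of_g_is_cokernel
  refine CokernelCofork.IsColimit.ofπ _ _
    (fun k hk => sq.desc k (h1.exact.desc (c ≫ k) (by simpa using hk)) 
      (h1.exact.g_desc (c ≫ k) (by simpa using hk)).symm) (fun k hk => ?_) (fun k hk m hm => ?_)
  · exact sq.inl_desc _ _ _
  · rw [← cancel_epi (pushout.inl c b)]
    exact hm.trans (sq.inl_desc _ _ _).symm

lemma ses_biprod (V : A) {X W C : A} {g : X ⟶ W} {e : W ⟶ C} {w : g ≫ e = 0}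
    (h : (ShortComplex.mk g e w).ShortExact) :
    ∃ w', (ShortComplex.mk (biprod.map (𝟙 V) g) (biprod.snd ≫ e) w').ShortExact := by
  have : Mono g := h.mono_f
  have : Epi e := h.epi_g
  have w' : biprod.map (𝟙 V) g ≫ biprod.snd ≫ e = 0 := by simp [w]
  refine ⟨w', ?_⟩
  have hm : Mono (biprod.map (𝟙 V) g) := inferInstance
  have he : Epi (biprod.snd ≫ e : V ⊞ W ⟶ C) := epi_comp _ _
  refine { exact := ?_ }
  apply ShortComplex.exact_of_f_is_kernel
  refine KernelFork.IsLimit.ofι _ _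
    (fun k hk => biprod.lift (k ≫ biprod.fst) (h.exact.lift (k ≫ biprod.snd) (by simpa using hk)))
    (fun k hk => ?_) (fun k hk m hm' => ?_)
  · have := h.exact.lift_f (k ≫ biprod.snd) (by simpa using hk)
    dsimp only at this ⊢
    apply biprod.hom_ext
    · simp
    · simpa using this
  · rw [← cancel_mono (biprod.map (𝟙 V) g)]
    refine hm'.trans ?_
    have := h.exact.lift_f (k ≫ biprod.snd) (by simpa using hk)
    dsimp only at this ⊢
    apply biprod.hom_ext
    · simp
    · simpa using this.symm

variable [HasExt.{w} A]

lemma ext_eq_zero_of_isZero {X Y : A} (hX : IsZero X) {n : ℕ} (x : Ext.{w} X Y n) : x = 0 := by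
  rw [← Ext.mk₀_id_comp x, hX.eq_of_src (𝟙 X) 0, Ext.mk₀_zero, Ext.zero_comp]

lemma ext_cores_eq_zero (𝒰 : Set A) (d : ℕ)
    (hv : ∀ i, 0 < i → i < d → ∀ U ∈ 𝒰, ∀ V ∈ 𝒰, ∀ x : Ext.{w} U V i, x = 0) (j : ℕ) :
    ∀ i, 0 < i → i + j ≤ d → ∀ X ∈ coresSet A 𝒰 j, ∀ V ∈ 𝒰, ∀ x : Ext.{w} X V i, x = 0 := by
  induction j with
  | zero => exact fun i _ _ X hX V _ x => ext_eq_zero_of_isZero hX x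
  | succ j ih =>
    intro i hi hij X hX V hV x
    obtain ⟨W, K, f, g, w, hS, hW, hK⟩ := coresSet_ses 𝒰 hX
    obtain ⟨y, hy⟩ := Ext.contravariant_sequence_exact₁ hS V x (n₁ := i + 1) (by lia)
      (ih (i + 1) (by lia) (by lia) K hK V hV _)
    rw [← hy, hv i hi (by lia) W hW V hV y, Ext.comp_zero]

lemma exists_retraction {S : ShortComplex A} (hS : S.ShortExact)
    (h : ∀ x : Ext.{w} S.X₃ S.X₁ 1, x = 0) : ∃ r : S.X₂ ⟶ S.X₁, S.f ≫ r = 𝟙 _ := by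
  obtain ⟨y, hy⟩ := Ext.contravariant_sequence_exact₁ hS S.X₁ (Ext.mk₀ (𝟙 _)) (n₁ := 1) rfl (h _)
  obtain ⟨r, rfl⟩ := (Ext.mk₀_bijective _ _).2 y
  exact ⟨r, (Ext.mk₀_bijective _ _).1 (by simpa using hy)⟩

lemma horseshoe (𝒰 : Set A) (d : ℕ) (hUadd : ∀ X Y : A, X ∈ 𝒰 → Y ∈ 𝒰 → (X ⊞ Y) ∈ 𝒰)
    (hUiso : ∀ X Y : A, (X ≅ Y) → X ∈ 𝒰 → Y ∈ 𝒰)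
    (hv : ∀ i, 0 < i → i < d → ∀ U ∈ 𝒰, ∀ V ∈ 𝒰, ∀ x : Ext.{w} U V i, x = 0) (j : ℕ) :
    j + 1 ≤ d → ∀ S : ShortComplex A, S.ShortExact → S.X₁ ∈ coresSet A 𝒰 (j + 1) →
      S.X₃ ∈ coresSet A 𝒰 j → S.X₂ ∈ coresSet A 𝒰 (j + 1) := by
  induction j with
  | zero =>
    intro _ S hS h1 h3
    have h3 : IsZero S.X₃ := h3
    have := hS.mono_f
    have : Epi S.f := hS.exact.epi_f (h3.eq_of_tgt _ _)
    have : IsIso S.f := isIso_of_mono_of_epi _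
    exact coresSet_iso 𝒰 hUiso _ (asIso S.f) h1
  | succ j ih =>
    intro hj S hS h1 h3
    obtain ⟨V, K, f, f', w1, hT1, hV, hK⟩ := coresSet_ses 𝒰 h1
    obtain ⟨W, L, g, g', w2, hT2, hW, hL⟩ := coresSet_ses 𝒰 h3
    have : Mono f := hT1.mono_f
    have sq := IsPushout.of_hasPushout S.f f
    obtain ⟨p, hp, wp, hP⟩ := ses_of_isPushout hS sq
    obtain ⟨p', hp', wp', hP'⟩ := ses_of_isPushout hT1 sq.flip
    obtain ⟨r, hr⟩ := exists_retraction hP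
      (fun x => ext_cores_eq_zero 𝒰 d hv (j + 1) 1 (by lia) (by lia) _ h3 V hV x)
    let sp := ShortComplex.Splitting.ofExactOfRetraction _ hP.exact r hr hP.epi_g
    let I : pushout S.f f ≅ V ⊞ S.X₃ := sp.isoBinaryBiproduct
    have w3 : (pushout.inl S.f f ≫ I.hom) ≫ I.inv ≫ p' = 0 := by simp [wp']
    have hR : (ShortComplex.mk (pushout.inl S.f f ≫ I.hom) (I.inv ≫ p') w3).ShortExact :=
      ShortComplex.shortExact_of_iso (S₁ := ShortComplex.mk (pushout.inl S.f f) p' wp')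
        (ShortComplex.isoMk (Iso.refl _) I (Iso.refl _) (by simp) (by simp)) hP'
    obtain ⟨w4, hR2⟩ := ses_biprod V hT2
    obtain ⟨Q, q, u, v, _, _, ⟨w5, hQ1⟩, ⟨w6, hQ2⟩⟩ := third_iso hR hR2
    exact coresSet_of_ses 𝒰 hUiso hQ1 (hUadd _ _ hV hW) (ih (by lia) _ hQ2 hK hL)

end coresolutions

section lifting

open Abelian

variable [HasExt.{w} A]

lemma Ch.cl_inj (t : Ch A) (Y : A) (n : ℕ) : ∀ (a b : ℕ) (hab : n + a = b), 1 ≤ a →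
    (∀ j < n, ∀ i, 1 ≤ i → i < b → ∀ x : Ext.{w} (t.E j) Y i, x = 0) →
    ∀ x : Ext.{w} (t.B n) Y a, (t.cl n).comp x hab = 0 → x = 0 := by
  induction n with
  | zero =>
    intro a b hab _ _ x hx
    obtain rfl : a = b := by lia
    rw [Ch.cl, Ext.mk₀_id_comp] at hx
    exact hx
  | succ n ih =>
    intro a b hab ha hv x hx
    rw [Ch.cl, Ext.comp_assoc (a₂₃ := 1 + a) _ _ _ _ rfl (by lia)] at hx
    have := ih (1 + a) b (by lia) (by lia) (fun j hj => hv j (by lia)) _ hx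
    obtain ⟨y, hy⟩ := Ext.contravariant_sequence_exact₁ (t.se n) Y x (n₁ := 1 + a) rfl this
    rw [← hy, hv n (by lia) a ha (by lia) y, Ext.comp_zero]

lemma Ch.lift_step (t s : Ch A) (h : t.B 0 ⟶ s.B 0) (n : ℕ) (g : t.B (n + 1) ⟶ s.B (n + 1))
    (hg : (t.cl (n + 1) : Ext.{w} _ _ _).comp (Ext.mk₀ g) (add_zero _) =
      (Ext.mk₀ h).comp (s.cl (n + 1)) (zero_add _))
    (hE : ∀ j < n, ∀ i, 1 ≤ i → i ≤ n → ∀ x : Ext.{w} (t.E j) (s.E n) i, x = 0)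
    (h0 : 1 ≤ n → ∀ x : Ext.{w} (t.B 0) (s.E n) n, x = 0) :
    ∃ (e : t.E n ⟶ s.E n) (b : t.B n ⟶ s.B n), t.ι n ≫ e = g ≫ s.ι n ∧
      t.π n ≫ b = e ≫ s.π n ∧
      (t.cl n : Ext.{w} _ _ _).comp (Ext.mk₀ b) (add_zero _) = (Ext.mk₀ h).comp (s.cl n) (zero_add _) := by
  -- the obstruction
  have key : (t.se n).extClass.comp (Ext.mk₀ (g ≫ s.ι n)) (add_zero 1) = 0 := by
    apply t.cl_inj (s.E n) n 1 (n + 1) rfl le_rfl (fun j hj i hi hi' => hE j hj i hi (by lia))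
    rw [← Ext.comp_assoc_of_third_deg_zero, ← Ch.cl, ← Ext.mk₀_comp_mk₀,
      ← Ext.comp_assoc_of_third_deg_zero, hg, Ext.comp_assoc_of_third_deg_zero, Ch.cl,
      Ext.comp_assoc_of_third_deg_zero, (s.se n).extClass_comp, Ext.comp_zero, Ext.comp_zero]
  obtain ⟨y, hy⟩ := Ext.contravariant_sequence_exact₁ (t.se n) (s.E n) (Ext.mk₀ (g ≫ s.ι n))
    (n₁ := 1) rfl key
  obtain ⟨e, rfl⟩ := (Ext.mk₀_bijective _ _).2 y
  have he : t.ι n ≫ e = g ≫ s.ι n := (Ext.mk₀_bijective _ _).1 (by simpa using hy)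
  have wb : t.ι n ≫ e ≫ s.π n = 0 := by
    rw [← Category.assoc, he, Category.assoc, s.w, comp_zero]
  let b : t.B n ⟶ s.B n := (t.se n).exact.desc (e ≫ s.π n) wb
  have hb : t.π n ≫ b = e ≫ s.π n := (t.se n).exact.g_desc (e ≫ s.π n) wb
  have nat : (t.se n).extClass.comp (Ext.mk₀ g) (add_zero 1) =
      (Ext.mk₀ b).comp (s.se n).extClass (zero_add 1) :=
    (t.se n).extClass_naturality (s.se n)
      { τ₁ := g, τ₂ := e, τ₃ := b, comm₁₂ := he.symm, comm₂₃ := hb.symm }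
  have hz : ((t.cl n : Ext.{w} _ _ _).comp (Ext.mk₀ b) (add_zero _) -
      (Ext.mk₀ h).comp (s.cl n) (zero_add _)).comp (s.se n).extClass (rfl : n + 1 = n + 1) = 0 := by
    rw [sub_eq_add_neg, Ext.add_comp, Ext.neg_comp, ← sub_eq_add_neg, Ext.comp_assoc_of_second_deg_zero, ← nat,
      ← Ext.comp_assoc_of_third_deg_zero, ← Ch.cl, hg,
      Ext.comp_assoc (a₂₃ := n + 1) _ _ _ _ rfl (by lia), ← Ch.cl, sub_self]
  obtain ⟨z, hz'⟩ := Ext.covariant_sequence_exact₃ (t.B 0) (s.se n) _ rfl hz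
  obtain _ | n := n
  · obtain ⟨z, rfl⟩ := (Ext.mk₀_bijective _ _).2 z
    refine ⟨e - t.π 0 ≫ z, b - z ≫ s.π 0, ?_, ?_, ?_⟩
    · rw [Preadditive.comp_sub, he, t.w_assoc, zero_comp, sub_zero]
    · rw [Preadditive.comp_sub, hb, Preadditive.sub_comp, Category.assoc]
    · dsimp only [Ch.cl] at hz' ⊢
      rw [Ext.mk₀_comp_mk₀, Ext.mk₀_comp_mk₀, Ext.mk₀_comp_mk₀, Category.id_comp,
        Category.comp_id, eq_sub_iff_add_eq, ← Ext.mk₀_add] at hz'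
      rw [Ext.mk₀_comp_mk₀, Ext.mk₀_comp_mk₀, Category.id_comp, Category.comp_id]
      rw [← (Ext.mk₀_bijective _ _).1 hz', add_sub_cancel_left]
  · refine ⟨e, b, he, hb, ?_⟩
    rw [h0 (by lia) z, Ext.zero_comp] at hz'
    exact sub_eq_zero.1 hz'.symm

lemma Ch.lift_aux (t s : Ch A) (h : t.B 0 ⟶ s.B 0) (d : ℕ)
    (hE : ∀ k < d, ∀ j < k, ∀ i, 1 ≤ i → i ≤ k → ∀ x : Ext.{w} (t.E j) (s.E k) i, x = 0)
    (h0 : ∀ k < d, 1 ≤ k → ∀ x : Ext.{w} (t.B 0) (s.E k) k, x = 0) (n : ℕ) : n ≤ d →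
    ∀ (β : ∀ i, t.B i ⟶ s.B i) (ε : ∀ i, t.E i ⟶ s.E i),
    (∀ i, n ≤ i → t.ι i ≫ ε i = β (i + 1) ≫ s.ι i) →
    (∀ i, n ≤ i → t.π i ≫ β i = ε i ≫ s.π i) →
    (t.cl n : Ext.{w} _ _ _).comp (Ext.mk₀ (β n)) (add_zero _) = (Ext.mk₀ h).comp (s.cl n) (zero_add _) →
    ∃ F : Ch.Hom t s, F.β 0 = h ∧ ∀ i, n ≤ i → F.β i = β i := by
  induction n with
  | zero =>
    intro _ β ε hι hπ hc
    refine ⟨⟨β, ε, fun i => hι i (by lia), fun i => hπ i (by lia)⟩, ?_, fun _ _ => rfl⟩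
    apply (Ext.mk₀_bijective _ _).1
    simpa [Ch.cl] using hc
  | succ n ih =>
    intro hn β ε hι hπ hc
    obtain ⟨e, b, h1, h2, h3⟩ := Ch.lift_step t s h n (β (n + 1)) hc (hE n (by lia))
      (h0 n (by lia))
    obtain ⟨F, hF0, hF⟩ := ih (by lia) (Function.update β n b) (Function.update ε n e)
      (fun i hi => by
        rcases eq_or_ne i n with rfl | hne
        · rw [Function.update_self, Function.update_of_ne (by lia)]; exact h1
        · rw [Function.update_of_ne hne, Function.update_of_ne (by lia)]; exact hι i (by lia))
      (fun i hi => by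
        rcases eq_or_ne i n with rfl | hne
        · rw [Function.update_self, Function.update_self]; exact h2
        · rw [Function.update_of_ne hne, Function.update_of_ne hne]; exact hπ i (by lia))
      (by rw [Function.update_self]; exact h3)
    refine ⟨F, hF0, fun i hi => ?_⟩
    rw [hF i (by lia), Function.update_of_ne (by lia)]

lemma Ch.lift (t s : Ch A) (d : ℕ) (ht : t.Bdd d) (hs : s.Bdd d)
    (h : t.B 0 ⟶ s.B 0) (g : t.B d ⟶ s.B d)
    (hE : ∀ k < d, ∀ j < k, ∀ i, 1 ≤ i → i ≤ k → ∀ x : Ext.{w} (t.E j) (s.E k) i, x = 0)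
    (h0 : ∀ k < d, 1 ≤ k → ∀ x : Ext.{w} (t.B 0) (s.E k) k, x = 0)
    (hc : (t.cl d : Ext.{w} _ _ _).comp (Ext.mk₀ g) (add_zero _) =
      (Ext.mk₀ h).comp (s.cl d) (zero_add _)) :
    ∃ F : Ch.Hom t s, F.β 0 = h ∧ F.β d = g := by
  have := hs.isIso_π
  obtain ⟨F, hF0, hF⟩ := Ch.lift_aux t s h d hE h0 d le_rfl
    (Function.update 0 d g) (Function.update 0 d (t.π d ≫ g ≫ inv (s.π d)))
    (fun i hi => (ht (i + 1) (by lia)).eq_of_src _ _)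
    (fun i hi => by
      rcases eq_or_ne i d with rfl | hne
      · simp
      · exact (ht.isZeroE i (by lia)).eq_of_src _ _)
    (by rw [Function.update_self]; exact hc)
  exact ⟨F, hF0, by rw [hF d le_rfl, Function.update_self]⟩

end lifting

section replacement

open Abelian ZeroObject

variable [HasExt.{w} A]

lemma Ch.replace (𝒰 : Set A) (k : ℕ) (hU0 : ∀ Z : A, IsZero Z → Z ∈ 𝒰)
    (hUadd : ∀ X Y : A, X ∈ 𝒰 → Y ∈ 𝒰 → (X ⊞ Y) ∈ 𝒰)
    (hUiso : ∀ X Y : A, (X ≅ Y) → X ∈ 𝒰 → Y ∈ 𝒰)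
    (hv : ∀ i, 0 < i → i < k + 1 → ∀ U ∈ 𝒰, ∀ V ∈ 𝒰, ∀ x : Ext.{w} U V i, x = 0) (n : ℕ) :
    ∀ C : Ch A, C.Bdd n → (∀ i, i ≤ n → C.B i ∈ coresSet A 𝒰 (k + 1)) →
      (∀ i, i < n → C.E i ∈ coresSet A 𝒰 (k + 1)) →
      ∃ D : Ch A, D.Bdd n ∧ (∀ i, i < n → D.E i ∈ 𝒰) ∧
        (∀ i, i ≤ n → D.B i ∈ coresSet A 𝒰 (k + 1)) ∧
        ∃ F : Ch.Hom C D, IsIso (F.β n) ∧ ∃ (K : A) (p : D.B 0 ⟶ K) (w : F.β 0 ≫ p = 0),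
          (ShortComplex.mk (F.β 0) p w).ShortExact ∧ K ∈ coresSet A 𝒰 k := by
  induction n with
  | zero =>
    intro C hC hB hE
    refine ⟨C, hC, fun i hi => by lia, hB, ⟨fun i => 𝟙 _, fun i => 𝟙 _, by simp, by simp⟩,
      by dsimp only; infer_instance, 0, 0, by simp, ?_,
      coresSet_le 𝒰 hU0 (Nat.zero_le k) (isZero_zero A)⟩
    have : Epi (0 : C.B 0 ⟶ 0) := (isZero_zero A).epi _
    refine { exact := ?_, mono_f := by dsimp only; infer_instance }
    rw [ShortComplex.exact_iff_epi _ rfl]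
    dsimp only
    infer_instance
  | succ n ih =>
    intro C hC hB hE
    obtain ⟨D, hD, hDE, hDB, F, hF, K, p, w, hS, hK⟩ := ih C.tail hC.tail
      (fun i hi => hB (i + 1) (by lia)) (fun i hi => hE (i + 1) (by lia))
    have sq : IsPushout (C.ι 0) (F.β 0) _ _ := IsPushout.of_hasPushout (C.ι 0) (F.β 0)
    obtain ⟨a, ha, wa, hSa⟩ := ses_of_isPushout (C.se 0) sq
    obtain ⟨b, hb, wb, hSb⟩ := ses_of_isPushout hS sq.flip
    have hP : pushout (C.ι 0) (F.β 0) ∈ coresSet A 𝒰 (k + 1) :=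
      horseshoe 𝒰 (k + 1) hUadd hUiso hv k le_rfl _ hSb (hE 0 (by lia)) hK
    obtain ⟨V, L, c, e, wc, hT, hV, hL⟩ := coresSet_ses 𝒰 hP
    obtain ⟨Q, q, u, v, h1, h2, ⟨w3, h3⟩, ⟨w4, h4⟩⟩ := third_iso hSa hT
    have hQ : Q ∈ coresSet A 𝒰 (k + 1) :=
      horseshoe 𝒰 (k + 1) hUadd hUiso hv k le_rfl _ h4 (hB 0 (by lia)) hL
    refine ⟨D.cons _ q w3 h3, hD.cons _ _ _ _, fun i hi => ?_, fun i hi => ?_,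
      F.cons (pushout.inl _ _ ≫ c) u ?_ ?_, hF, L, v, w4, h4, hL⟩
    · obtain _ | i := i
      · exact hV
      · exact hDE i (by lia)
    · obtain _ | i := i
      · exact hQ
      · exact hDB i (by lia)
    · rw [reassoc_of% sq.w]
    · rw [Category.assoc, ← h1, ← Category.assoc]
      exact ha.symm =≫ u

lemma Ch.replace_top (𝒰 : Set A) (k : ℕ) (hU0 : ∀ Z : A, IsZero Z → Z ∈ 𝒰)
    (hUadd : ∀ X Y : A, X ∈ 𝒰 → Y ∈ 𝒰 → (X ⊞ Y) ∈ 𝒰)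
    (hUiso : ∀ X Y : A, (X ≅ Y) → X ∈ 𝒰 → Y ∈ 𝒰)
    (hv : ∀ i, 0 < i → i < k + 1 → ∀ U ∈ 𝒰, ∀ V ∈ 𝒰, ∀ x : Ext.{w} U V i, x = 0) (n : ℕ)
    (C : Ch A) (hC : C.Bdd (n + 1)) (hB : ∀ i, i ≤ n + 1 → C.B i ∈ coresSet A 𝒰 (k + 1))
    (hE : ∀ i, i < n + 1 → C.E i ∈ coresSet A 𝒰 (k + 1)) :
    ∃ D : Ch A, D.Bdd (n + 1) ∧ (∀ i, 1 ≤ i → i < n + 1 → D.E i ∈ 𝒰) ∧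
      (∀ i, i < n + 1 → D.E i ∈ coresSet A 𝒰 (k + 1)) ∧
      (∀ i, i ≤ n + 1 → D.B i ∈ coresSet A 𝒰 (k + 1)) ∧
      ∃ F : Ch.Hom C D, IsIso (F.β (n + 1)) ∧ IsIso (F.β 0) := by
  obtain ⟨D, hD, hDE, hDB, F, hF, K, p, w, hS, hK⟩ := Ch.replace 𝒰 k hU0 hUadd hUiso hv n C.tail
    hC.tail (fun i hi => hB (i + 1) (by lia)) (fun i hi => hE (i + 1) (by lia))
  have sq : IsPushout (C.ι 0) (F.β 0) _ _ := IsPushout.of_hasPushout (C.ι 0) (F.β 0)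
  obtain ⟨a, ha, wa, hSa⟩ := ses_of_isPushout (C.se 0) sq
  obtain ⟨b, hb, wb, hSb⟩ := ses_of_isPushout hS sq.flip
  have hP : pushout (C.ι 0) (F.β 0) ∈ coresSet A 𝒰 (k + 1) :=
    horseshoe 𝒰 (k + 1) hUadd hUiso hv k le_rfl _ hSb (hE 0 (by lia)) hK
  refine ⟨D.cons _ a wa hSa, hD.cons _ _ _ _, fun i h1 hi => ?_, fun i hi => ?_, fun i hi => ?_,
    F.cons (pushout.inl _ _) (𝟙 _) sq.w ?_, hF, ?_⟩
  · obtain _ | i := i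
    · lia
    · exact hDE i (by lia)
  · obtain _ | i := i
    · exact hP
    · exact coresSet_le 𝒰 hU0 (by lia) (mem_coresSet_one 𝒰 (hDE i (by lia)))
  · obtain _ | i := i
    · exact hB 0 (by lia)
    · exact hDB i (by lia)
  · rw [Category.comp_id]
    exact ha.symm
  · change IsIso (𝟙 (C.B 0))
    infer_instance

lemma Ch.allIn_toExtSeq (𝒰 : Set A) (hUiso : ∀ X Y : A, (X ≅ Y) → X ∈ 𝒰 → Y ∈ 𝒰) (m : ℕ)
    {n : ℕ} {X Y : A} (C : Ch A) (hC : C.Bdd n) (i : C.B 0 ≅ X)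
    (j : C.B n ≅ Y) (hE : ∀ i, i < n → C.E i ∈ coresSet A 𝒰 m)
    (hB : ∀ i, i ≤ n → C.B i ∈ coresSet A 𝒰 m) :
    (C.toExtSeq hC i j).allIn (coresSet A 𝒰 m) := by
  constructor
  · intro i hi
    obtain _ | i := i
    · exact hB 0 (by lia)
    · rcases Nat.lt_or_ge i n with h | h
      · exact hE i h
      · obtain rfl : i = n := by lia
        have := hC.isIso_π
        exact coresSet_iso 𝒰 hUiso m (asIso (C.π i)).symm (hB i le_rfl)
  · intro i h1 hi
    obtain _ | i := i
    · lia
    · have : StrongEpi (C.π (i + 1)) := strongEpi_of_epi _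
      exact coresSet_iso 𝒰 hUiso m
        (image.isoStrongEpiMono (f := C.π (i + 1) ≫ C.ι i) (C.π (i + 1)) (C.ι i) rfl)
        (hB (i + 1) (by lia))

lemma ExtSeq.replace (𝒰 : Set A) (k : ℕ) (hU0 : ∀ Z : A, IsZero Z → Z ∈ 𝒰)
    (hUadd : ∀ X Y : A, X ∈ 𝒰 → Y ∈ 𝒰 → (X ⊞ Y) ∈ 𝒰)
    (hUiso : ∀ X Y : A, (X ≅ Y) → X ∈ 𝒰 → Y ∈ 𝒰)
    (hv : ∀ i, 0 < i → i < k + 1 → ∀ U ∈ 𝒰, ∀ V ∈ 𝒰, ∀ x : Ext.{w} U V i, x = 0)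
    {X Y : A} (s : ExtSeq A (k + 1) X Y) (hs : s.allIn (coresSet A 𝒰 (k + 1))) :
    ∃ t : ExtSeq A (k + 1) X Y, t.allIn (coresSet A 𝒰 (k + 1)) ∧
      (∀ j, 1 ≤ j → j < k + 1 → t.ob (j + 1) ∈ 𝒰) ∧ Nonempty (ExtSeqHom s t) := by
  obtain ⟨D, hD, hD1, hDE, hDB, F, hF1, hF0⟩ := Ch.replace_top 𝒰 k hU0 hUadd hUiso hv k s.ch
    s.dec.bdd
    (fun i hi => by
      obtain _ | i := i
      · exact coresSet_iso 𝒰 hUiso _ s.dec.e0 (hs.1 0 (by lia))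
      · exact hs.2 (i + 1) (by lia) hi)
    (fun i hi => hs.1 (i + 1) (by lia))
  let i := (asIso (F.β 0)).symm ≪≫ s.dec.bot
  let j := (asIso (F.β (k + 1))).symm ≪≫ s.dec.top
  refine ⟨D.toExtSeq hD i j, D.allIn_toExtSeq 𝒰 hUiso _ hD i j hDE hDB, hD1,
    ⟨s.dec.toExtSeqHom (D.dec hD i j) F ?_ ?_⟩⟩
  · rw [D.dec_bot]; simp [i]
  · rw [D.dec_top]; simp [j]

lemma ExtSeq.allIn_of_mid (𝒰 : Set A) (hU0 : ∀ Z : A, IsZero Z → Z ∈ 𝒰)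
    (hUiso : ∀ X Y : A, (X ≅ Y) → X ∈ 𝒰 → Y ∈ 𝒰) {d : ℕ} (hd : 1 ≤ d)
    {X Y : A} (hX : X ∈ 𝒰) (hY : Y ∈ 𝒰) (s : ExtSeq A d X Y)
    (hs : ∀ i, 1 ≤ i → i ≤ d → s.ob i ∈ 𝒰) : s.allIn (coresSet A 𝒰 d) := by
  have hU : ∀ Z ∈ 𝒰, Z ∈ coresSet A 𝒰 d := fun Z hZ =>
    coresSet_le 𝒰 hU0 hd (mem_coresSet_one 𝒰 hZ)
  constructor
  · intro i hi
    apply hU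
    obtain _ | i := i
    · exact hUiso _ _ s.iso0.symm hX
    · rcases Nat.lt_or_ge i d with h | h
      · exact hs (i + 1) (by lia) (by lia)
      · obtain rfl : i = d := by lia
        exact hUiso _ _ s.isoTop.symm hY
  · have key : ∀ i, i < d → s.ch.B i ∈ coresSet A 𝒰 (i + 1) := by
      intro i
      induction i with
      | zero => exact fun _ => mem_coresSet_one 𝒰 (hUiso _ _ s.dec.bot.symm hX)
      | succ i ih =>
        intro hi
        exact coresSet_of_ses 𝒰 hUiso (s.ch.se i) (hs (i + 1) (by lia) (by lia)) (ih (by lia))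
    intro i _ hi
    rcases Nat.lt_or_ge i d with h | h
    · exact coresSet_le 𝒰 hU0 (by lia) (key i h)
    · obtain rfl : i = d := by lia
      exact hU _ (hUiso _ _ s.dec.top.symm hY)

lemma ExtSeq.lift (𝒰 : Set A) (hUiso : ∀ X Y : A, (X ≅ Y) → X ∈ 𝒰 → Y ∈ 𝒰) {d : ℕ}
    (hv : ∀ i, 0 < i → i < d → ∀ U ∈ 𝒰, ∀ V ∈ 𝒰, ∀ x : Ext.{w} U V i, x = 0)
    {X Y : A} (hX : X ∈ 𝒰) (t s : ExtSeq A d X Y) (ht : ∀ i, 1 ≤ i → i ≤ d → t.ob i ∈ 𝒰)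
    (hs : ∀ j, 1 ≤ j → j < d → s.ob (j + 1) ∈ 𝒰) (h : (t.cls : Ext.{w} X Y d) = s.cls) :
    Nonempty (ExtSeqHom t s) := by
  have hc : (t.ch.cl d : Ext.{w} _ _ _).comp
        (Ext.mk₀ (t.dec.top.hom ≫ s.dec.top.inv)) (add_zero _) =
      (Ext.mk₀ (t.dec.bot.hom ≫ s.dec.bot.inv)).comp (s.ch.cl d) (zero_add _) := by
    have h2 := congrArg (fun x : Ext.{w} X Y d => (Ext.mk₀ t.dec.bot.hom).comp
      (x.comp (Ext.mk₀ s.dec.top.inv) (add_zero d)) (zero_add d)) h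
    simp only [ExtSeq.cls, Dec.cls] at h2
    rw [Ext.comp_assoc_of_third_deg_zero, Ext.comp_assoc_of_third_deg_zero,
      Ext.comp_assoc_of_third_deg_zero, Ext.comp_assoc_of_third_deg_zero,
      Ext.mk₀_comp_mk₀, Ext.mk₀_comp_mk₀, Ext.mk₀_comp_mk₀_assoc, Ext.mk₀_comp_mk₀_assoc,
      Iso.hom_inv_id, Iso.hom_inv_id, Ext.mk₀_id_comp, Ext.comp_mk₀_id] at h2
    exact h2
  obtain ⟨F, hF0, hFd⟩ := Ch.lift t.ch s.ch d t.dec.bdd s.dec.bdd _ _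
    (fun k hk j hj i hi hik x => hv i hi (by lia) _ (ht (j + 1) (by lia) (by lia)) _
      (hs k (by lia) hk) x)
    (fun k hk h1 x => hv k h1 hk _ (hUiso _ _ t.dec.bot.symm hX) _ (hs k h1 hk) x) hc
  exact ⟨t.dec.toExtSeqHom s.dec F (by rw [hF0]; simp) (by rw [hFd]; simp)⟩

end replacement

/-- if `𝒰` is `d`-rigid and `d`-extension closed in `A`, then the canonical
map `Ext^d_{𝒰^d(A)}(U, V) → Ext^d_A(U, V)` is a bijection for all `U, V ∈ 𝒰`:
it is injective (extensions in `𝒰^d(A)` that are Yoneda equivalent in `A` are already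
Yoneda equivalent in `𝒰^d(A)`) and surjective (every `d`-extension in `A` is Yoneda
equivalent to one lying in `𝒰^d(A)`). -/
theorem ext_coresSet_to_ext_ambient_bijective
    (A : Type u) [Category.{v} A] [Abelian A] (d : ℕ) (hd : 1 ≤ d)
    (𝒰 : Set A)
    (hU0 : ∀ Z : A, IsZero Z → Z ∈ 𝒰)
    (hUadd : ∀ X Y : A, X ∈ 𝒰 → Y ∈ 𝒰 → (X ⊞ Y) ∈ 𝒰)
    (hUiso : ∀ X Y : A, (X ≅ Y) → X ∈ 𝒰 → Y ∈ 𝒰)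
    (hrigid : ∀ i, 0 < i → i < d → ∀ U ∈ 𝒰, ∀ U' ∈ 𝒰, extVanish A i U U')
    (hdec : DExtClosed A 𝒰 d) :
    ∀ U ∈ 𝒰, ∀ V ∈ 𝒰,
      (∀ s t : ExtSeq A d U V, s.allIn (coresSet A 𝒰 d) → t.allIn (coresSet A 𝒰 d) →
        YonedaEquiv s t → YonedaEquivIn (coresSet A 𝒰 d) s t) ∧
      (∀ s : ExtSeq A d U V,
        ∃ t : ExtSeq A d U V, t.allIn (coresSet A 𝒰 d) ∧ YonedaEquiv s t) := by
  haveI : HasExt.{max u v} A := HasExt.standard A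
  have hv : ∀ i, 0 < i → i < d → ∀ U ∈ 𝒰, ∀ V ∈ 𝒰, ∀ x : Abelian.Ext.{max u v} U V i, x = 0 :=
    fun i hi hid U hU V hV x => ext_eq_zero_of_extVanish hi (hrigid i hi hid U hU V hV) x
  intro X hX Y hY
  constructor
  · intro s t hs ht hst
    obtain ⟨k, rfl⟩ : ∃ k, d = k + 1 := ⟨d - 1, by lia⟩
    obtain ⟨s1, hs1, hs1', ⟨φ⟩⟩ := s.replace 𝒰 k hU0 hUadd hUiso hv hs
    obtain ⟨t1, ht1, ht1', ⟨ψ⟩⟩ := t.replace 𝒰 k hU0 hUadd hUiso hv ht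
    obtain ⟨r, hr, hsr⟩ := hdec X Y hX hY s1
    have hrall := r.allIn_of_mid 𝒰 hU0 hUiso hd hX hY hr
    have hss1 : YonedaEquiv s s1 := Relation.EqvGen.rel _ _ ⟨φ⟩
    have htt1 : YonedaEquiv t t1 := Relation.EqvGen.rel _ _ ⟨ψ⟩
    have c1 : (r.cls : Abelian.Ext.{max u v} X Y (k + 1)) = s1.cls := hsr.cls_eq.symm
    have c2 : (r.cls : Abelian.Ext.{max u v} X Y (k + 1)) = t1.cls :=
      c1.trans (hss1.cls_eq.symm.trans (hst.cls_eq.trans htt1.cls_eq))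
    have e1 := ExtSeq.lift 𝒰 hUiso hv hX r s1 hr hs1' c1
    have e2 := ExtSeq.lift 𝒰 hUiso hv hX r t1 hr ht1' c2
    refine .trans _ s1 _ (.rel _ _ ⟨hs, hs1, ⟨φ⟩⟩) ?_
    refine .trans _ r _ (.symm _ _ (.rel _ _ ⟨hrall, hs1, e1⟩)) ?_
    refine .trans _ t1 _ (.rel _ _ ⟨hrall, ht1, e2⟩) ?_
    exact .symm _ _ (.rel _ _ ⟨ht, ht1, ⟨ψ⟩⟩)
  · intro s
    obtain ⟨t, ht, hst⟩ := hdec X Y hX hY s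
    exact ⟨t, t.allIn_of_mid 𝒰 hU0 hUiso hd hX hY ht, hst⟩
end
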